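/- arXiv:2011.02934 — 4 statements merged into one kernel-verified Lean document; each statement's English description precedes it below -/
import Mathlib

section
/- Let (Ω, 𝒜) be a measurable space, let U ⊆ ℂ be open, and let f : Ω × U → ℂ be such that f(ω,·) is holomorphic on U for every ω ∈ Ω and f(·,z) is measurable for every z ∈ U. Let K be a compact subset of U. Then there exists a sequence R₁, R₂, … of random rational functions pole-free on K such that for every ω ∈ Ω the functions Rₙ(ω,·) converge to f(ω,·) uniformly on K. -/
namespace RandomRunge

open Filter Topology MeasureTheory Set

/-- Twice the Wirtinger derivative with respect to the conjugate variable. -/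
noncomputable def dbar (G : ℂ → ℂ) (w : ℂ) : ℂ :=
  fderiv ℝ G w 1 + Complex.I * fderiv ℝ G w Complex.I

lemma dbar_congr {G H : ℂ → ℂ} {x : ℂ} (h : G =ᶠ[𝓝 x] H) : dbar G x = dbar H x := by
  simp [dbar, h.fderiv_eq]

lemma dbar_eventually_zero {G : ℂ → ℂ} {x c : ℂ} (h : G =ᶠ[𝓝 x] fun _ => c) :
    dbar G =ᶠ[𝓝 x] 0 := by
  filter_upwards [h.eventuallyEq_nhds] with y hy
  rw [dbar_congr hy]
  simp [dbar]

lemma continuous_dbar {G : ℂ → ℂ} (hG : ContDiff ℝ 1 G) : Continuous (dbar G) := by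
  have := hG.continuous_fderiv (by norm_num)
  unfold dbar
  fun_prop

lemma hasCompactSupport_dbar {G : ℂ → ℂ} (hc : HasCompactSupport G) :
    HasCompactSupport (dbar G) := by
  refine hc.mono' fun x hx => ?_
  by_contra h
  apply hx
  exact (dbar_eventually_zero (c := 0) (notMem_tsupport_iff_eventuallyEq.1 h)).self_of_nhds

lemma integral_dbar {G : ℂ → ℂ} (hG : ContDiff ℝ 1 G) (hc : HasCompactSupport G) :
    ∫ w, dbar G w = 0 := by
  have hcont := hG.continuous_fderiv (by norm_num)
  have hint : ∀ v : ℂ, Integrable (fun w => fderiv ℝ G w v) := fun v =>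
    Continuous.integrable_of_hasCompactSupport (by fun_prop) (hc.fderiv_apply (𝕜 := ℝ) v)
  have hz : ∀ v : ℂ, ∫ w, fderiv ℝ G w v = 0 := by
    intro v
    have := integral_mul_fderiv_eq_neg_fderiv_mul_of_integrable (μ := (volume : Measure ℂ))
      (𝕜 := ℂ) (f := fun _ : ℂ => (1 : ℂ)) (g := G) (v := v) (by simp) (by simpa using hint v)
      (by simpa using hG.continuous.integrable_of_hasCompactSupport hc) (by simp)
      (fun x _ => hG.differentiable (by norm_num) x)
    simpa using this
  unfold dbar
  rw [integral_add (hint _) ((hint _).const_mul _), integral_const_mul, hz, hz]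
  simp

lemma continuous_mul_of {a b : ℂ → ℂ} {V : Set ℂ} (hV : IsOpen V) (ha : Continuous a)
    (hb : ContinuousOn b V) (h0 : ∀ x ∉ V, a =ᶠ[𝓝 x] 0) : Continuous fun w => a w * b w := by
  rw [continuous_iff_continuousAt]
  intro x
  by_cases hx : x ∈ V
  · exact ha.continuousAt.mul (hb.continuousAt (hV.mem_nhds hx))
  · have : (fun w => a w * b w) =ᶠ[𝓝 x] fun _ => 0 := by
      filter_upwards [h0 x hx] with y hy
      simp [hy]
    exact continuousAt_const.congr this.symm

lemma integral_dbar_mul {ψ k : ℂ → ℂ} {V : Set ℂ} (hV : IsOpen V) (hψ : ContDiff ℝ 1 ψ)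
    (hc : HasCompactSupport ψ) (hk : DifferentiableOn ℂ k V) (h0 : ∀ x ∉ V, ψ =ᶠ[𝓝 x] 0) :
    ∫ w, dbar ψ w * k w = 0 := by
  have hz : ∀ x ∉ V, (fun w => ψ w * k w) =ᶠ[𝓝 x] fun _ => 0 := by
    intro x hx
    filter_upwards [h0 x hx] with y hy
    simp [hy]
  have hG : ContDiff ℝ 1 (fun w => ψ w * k w) := by
    rw [contDiff_iff_contDiffAt]
    intro x
    by_cases hx : x ∈ V
    · have h1 : ContDiffAt ℂ 1 k x := (hk.analyticAt (hV.mem_nhds hx)).contDiffAt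
      exact hψ.contDiffAt.mul (h1.restrict_scalars ℝ)
    · exact contDiffAt_const.congr_of_eventuallyEq (hz x hx)
  have hcG : HasCompactSupport (fun w => ψ w * k w) := hc.mul_right
  rw [← integral_dbar hG hcG]
  congr 1
  ext w
  by_cases hw : w ∈ V
  · have h1 : DifferentiableAt ℂ k w := hk.differentiableAt (hV.mem_nhds hw)
    have h2 : fderiv ℝ k w = (fderiv ℂ k w).restrictScalars ℝ := h1.fderiv_restrictScalars ℝ
    have h3 : fderiv ℂ k w Complex.I = Complex.I * fderiv ℂ k w 1 := by
      rw [← smul_eq_mul, ← map_smul]; simp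
    unfold dbar
    rw [fderiv_fun_mul (hψ.differentiable (by norm_num) w) (h1.restrictScalars ℝ), h2]
    simp only [ContinuousLinearMap.add_apply, ContinuousLinearMap.smul_apply,
      ContinuousLinearMap.coe_restrictScalars', smul_eq_mul, h3]
    linear_combination (ψ w * fderiv ℂ k w 1) * (- Complex.I_mul_I)
  · rw [(dbar_eventually_zero (h0 w hw)).self_of_nhds, (dbar_eventually_zero (hz w hw)).self_of_nhds]
    simp

lemma integrable_dbar_mul {φ b : ℂ → ℂ} {V : Set ℂ} (hV : IsOpen V) (hφ : ContDiff ℝ 1 φ)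
    (hc : HasCompactSupport φ) (hb : ContinuousOn b V)
    (h0 : ∀ x ∉ V, dbar φ =ᶠ[𝓝 x] 0) : Integrable fun w => dbar φ w * b w :=
  (continuous_mul_of hV (continuous_dbar hφ) hb h0).integrable_of_hasCompactSupport
    (hasCompactSupport_dbar hc).mul_right

lemma exists_chi : ∃ χ : ℂ → ℂ, ContDiff ℝ 1 χ ∧ HasCompactSupport χ ∧
    χ =ᶠ[𝓝 0] (fun _ => 1) ∧ ∫ w, dbar χ w * (w - 0)⁻¹ ≠ 0 := by
  set s := Real.smoothTransition with hs
  have hsC : ContDiff ℝ 1 s := Real.smoothTransition.contDiff (n := 1)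
  have hsd : Differentiable ℝ s := hsC.differentiable (by norm_num)
  have hns : ContDiff ℝ 1 (fun w : ℂ => 2 - ‖w‖ ^ 2) := contDiff_const.sub (contDiff_norm_sq ℝ)
  have hzero : ∀ w : ℂ, 2 ≤ ‖w‖ → 2 - ‖w‖ ^ 2 < 0 := by intro w hw; nlinarith
  refine ⟨fun w => ((s (2 - ‖w‖ ^ 2) : ℝ) : ℂ), ?_, ?_, ?_, ?_⟩
  · exact Complex.ofRealCLM.contDiff.comp (hsC.comp hns)
  · refine HasCompactSupport.intro (isCompact_closedBall (0 : ℂ) 2) fun w hw => ?_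
    have : 2 ≤ ‖w‖ := by simp at hw; exact hw.le
    simp [hs, Real.smoothTransition.zero_of_nonpos (hzero w this).le]
  · have : Metric.ball (0 : ℂ) 1 ∈ 𝓝 0 := Metric.ball_mem_nhds _ one_pos
    filter_upwards [this] with w hw
    have : ‖w‖ < 1 := by simpa using hw
    rw [hs, Real.smoothTransition.one_of_one_le]
    · simp
    · nlinarith [norm_nonneg w]
  · have hd : ∀ w : ℂ, w ≠ 0 → dbar (fun w => ((s (2 - ‖w‖ ^ 2) : ℝ) : ℂ)) w * (w - 0)⁻¹
        = ((-2 * deriv s (2 - ‖w‖ ^ 2) : ℝ) : ℂ) := by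
      intro w hw
      have h1 := ((hasStrictFDerivAt_norm_sq w).hasFDerivAt.const_sub 2)
      have h2 := (hsd (2 - ‖w‖ ^ 2)).hasDerivAt.comp_hasFDerivAt w h1
      have h3 := Complex.ofRealCLM.hasFDerivAt.comp w h2
      have h4 : fderiv ℝ (fun w : ℂ => ((s (2 - ‖w‖ ^ 2) : ℝ) : ℂ)) w = _ := h3.fderiv
      unfold dbar
      rw [h4]
      simp
      field_simp
      apply Complex.ext <;> simp
    have hcont : Continuous fun w : ℂ => deriv s (2 - ‖w‖ ^ 2) :=
      (hsC.continuous_deriv (by norm_num)).comp hns.continuous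
    have hpos : 0 < ∫ w : ℂ, deriv s (2 - ‖w‖ ^ 2) := by
      obtain ⟨t, ht, hts⟩ := exists_deriv_eq_slope s (zero_lt_one) hsd.continuous.continuousOn
        hsd.differentiableOn
      refine hcont.integral_pos_of_hasCompactSupport_nonneg_nonzero (x := ((√(2 - t) : ℝ) : ℂ))
        ?_ ?_ ?_
      · refine HasCompactSupport.intro (isCompact_closedBall (0 : ℂ) 2) fun w hw => ?_
        have : 2 ≤ ‖w‖ := by simp at hw; exact hw.le
        have h5 : s =ᶠ[𝓝 (2 - ‖w‖ ^ 2)] fun _ => 0 := by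
          filter_upwards [Iio_mem_nhds (hzero w this)] with y hy
          exact Real.smoothTransition.zero_of_nonpos (le_of_lt hy)
        rw [h5.deriv_eq]; simp
      · intro w
        exact Real.smoothTransition.monotone.deriv_nonneg
      · have : 0 ≤ 2 - t := by linarith [ht.2]
        simp only [Complex.norm_real, Real.norm_eq_abs, sq_abs, Real.sq_sqrt this]
        rw [show 2 - (2 - t) = t by ring, hts]
        simp [hs, Real.smoothTransition.zero, Real.smoothTransition.one]
    have : ∫ w, dbar (fun w => ((s (2 - ‖w‖ ^ 2) : ℝ) : ℂ)) w * (w - 0)⁻¹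
        = ∫ w : ℂ, ((-2 * deriv s (2 - ‖w‖ ^ 2) : ℝ) : ℂ) := by
      apply integral_congr_ae
      have h6 : ∀ᵐ w : ℂ, w ≠ 0 := by simp [ae_iff]
      filter_upwards [h6] with w hw using hd w hw
    rw [this, integral_complex_ofReal, integral_const_mul]
    exact_mod_cast (by nlinarith : -2 * ∫ w : ℂ, deriv s (2 - ‖w‖ ^ 2) < 0).ne

lemma exists_const : ∃ c : ℂ, c ≠ 0 ∧ ∀ (φ : ℂ → ℂ) (z : ℂ), ContDiff ℝ 1 φ →
    HasCompactSupport φ → φ =ᶠ[𝓝 z] (fun _ => 1) → ∫ w, dbar φ w * (w - z)⁻¹ = c := by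
  obtain ⟨χ, hχ, hχc, hχ1, hne⟩ := exists_chi
  refine ⟨_, hne, fun φ z hφ hφc hφ1 => ?_⟩
  have hsub : ContDiff ℝ 1 (fun w : ℂ => w - z) := contDiff_id.sub contDiff_const
  have hχz : ContDiff ℝ 1 (fun w => χ (w - z)) := hχ.comp hsub
  have hχzc : HasCompactSupport (fun w => χ (w - z)) :=
    hχc.comp_homeomorph (Homeomorph.subRight z)
  have hχz1 : (fun w => χ (w - z)) =ᶠ[𝓝 z] fun _ => 1 := by
    have : Tendsto (fun w : ℂ => w - z) (𝓝 z) (𝓝 0) := by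
      have := hsub.continuous.tendsto z
      simpa using this
    exact this.eventually hχ1
  have hd : ∀ w, dbar (fun w => χ (w - z)) w = dbar χ (w - z) := by
    intro w
    simp [dbar, fderiv_comp_sub]
  have ht : ∫ w, dbar (fun w => χ (w - z)) w * (w - z)⁻¹ = ∫ w, dbar χ w * (w - 0)⁻¹ := by
    simp_rw [hd, sub_zero]
    exact integral_sub_right_eq_self (fun w => dbar χ w * w⁻¹) z
  rw [← ht, ← sub_eq_zero]
  have hk : DifferentiableOn ℂ (fun w : ℂ => (w - z)⁻¹) {z}ᶜ := by
    intro w hw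
    refine DifferentiableAt.differentiableWithinAt ?_
    exact DifferentiableAt.inv (by fun_prop) (sub_ne_zero.2 hw)
  have hV : IsOpen ({z}ᶜ : Set ℂ) := isOpen_compl_singleton
  rw [← integral_sub
    (integrable_dbar_mul hV hφ hφc hk.continuousOn
      (by intro x hx; obtain rfl : x = z := by simpa using hx
          exact dbar_eventually_zero hφ1))
    (integrable_dbar_mul hV hχz hχzc hk.continuousOn
      (by intro x hx; obtain rfl : x = z := by simpa using hx
          exact dbar_eventually_zero hχz1))]
  rw [← integral_dbar_mul hV (hφ.sub hχz) (hφc.sub hχzc) hk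
    (by intro x hx; obtain rfl : x = z := by simpa using hx
        filter_upwards [hφ1, hχz1] with y h1 h2
        simp [h1, h2])]
  congr 1
  ext w
  rw [← sub_mul]
  congr 1
  unfold dbar
  rw [fderiv_fun_sub (hφ.differentiable (by norm_num) w) (hχz.differentiable (by norm_num) w)]
  simp
  ring

/-- The subspace of rational functions without poles on `K`. -/
def ratSub (K : Set ℂ) : Submodule ℂ C(K, ℂ) where
  carrier := {r | ∃ p q : Polynomial ℂ, (∀ z ∈ K, q.eval z ≠ 0) ∧
    ∀ z : K, r z = p.eval (z : ℂ) / q.eval (z : ℂ)}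
  zero_mem' := ⟨0, 1, by simp, by simp⟩
  add_mem' := by
    rintro r s ⟨p, q, hq, hr⟩ ⟨p', q', hq', hs⟩
    refine ⟨p * q' + q * p', q * q', ?_, ?_⟩
    · intro z hz
      simp [hq z hz, hq' z hz]
    · intro z
      have h1 := hq z z.2
      have h2 := hq' z z.2
      simp [hr, hs, div_add_div _ _ h1 h2]
  smul_mem' := by
    rintro c r ⟨p, q, hq, hr⟩
    refine ⟨Polynomial.C c * p, q, hq, ?_⟩
    intro z
    simp [hr, mul_div_assoc]

lemma exists_cutoff {U K : Set ℂ} (hU : IsOpen U) (hK : IsCompact K) (hKU : K ⊆ U) :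
    ∃ φ : ℂ → ℂ, ContDiff ℝ 1 φ ∧ HasCompactSupport φ ∧ (∀ x ∉ U, φ =ᶠ[𝓝 x] 0) ∧
      ∀ z ∈ K, φ =ᶠ[𝓝 z] fun _ => 1 := by
  obtain ⟨L, hL, hKL, hLU⟩ := exists_compact_between hK hU hKU
  obtain ⟨φ, h1, h0, -⟩ := exists_contMDiffMap_one_nhds_of_subset_interior (n := 1)
    (modelWithCornersSelf ℝ ℂ) hK.isClosed hKL
  refine ⟨fun w => (φ w : ℂ), ?_, ?_, ?_, ?_⟩
  · exact Complex.ofRealCLM.contDiff.comp φ.contMDiff.contDiff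
  · exact HasCompactSupport.intro hL fun x hx => by simp [h0 x hx]
  · intro x hx
    filter_upwards [hL.isClosed.isOpen_compl.mem_nhds (fun h => hx (hLU h))] with y hy
    simp [h0 y hy]
  · intro z hz
    filter_upwards [(eventually_nhdsSet_iff_forall.1 h1) z hz] with y hy
    simp [hy]

lemma runge {U K : Set ℂ} (hU : IsOpen U) (hK : IsCompact K) (hKU : K ⊆ U) {f : ℂ → ℂ}
    (hf : DifferentiableOn ℂ f U) (F : C(K, ℂ)) (hF : ∀ z : K, F z = f z) :
    F ∈ (ratSub K).topologicalClosure := by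
  have : CompactSpace K := isCompact_iff_compactSpace.1 hK
  obtain ⟨c, hc, hconst⟩ := exists_const
  obtain ⟨φ, hφ, hφc, hφ0, hφ1⟩ := exists_cutoff hU hK hKU
  have hd0 : ∀ z ∈ K, dbar φ =ᶠ[𝓝 z] 0 := fun z hz => dbar_eventually_zero (hφ1 z hz)
  set g : ℂ → ℂ := fun w => dbar φ w * f w with hg
  have hgc : Continuous g := continuous_mul_of hU (continuous_dbar hφ) hf.continuousOn
    fun x hx => dbar_eventually_zero (hφ0 x hx)
  have hH : Continuous fun p : ℂ × K => g p.1 * (p.1 - (p.2 : ℂ))⁻¹ := by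
    rw [continuous_iff_continuousAt]
    rintro ⟨w, z⟩
    by_cases hw : w = z
    · have h1 : ∀ᶠ p : ℂ × K in 𝓝 (w, z), dbar φ p.1 = 0 :=
        (continuous_fst.tendsto (w, z)).eventually (hd0 w (hw ▸ z.2))
      refine (continuousAt_const (y := (0 : ℂ))).congr ?_
      filter_upwards [h1] with p hp
      simp [hg, hp]
    · refine ContinuousAt.mul (by fun_prop) (ContinuousAt.inv₀ (by fun_prop) (sub_ne_zero.2 hw))
  set h : C(ℂ, C(K, ℂ)) := ContinuousMap.curry ⟨_, hH⟩ with hh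
  have happ : ∀ w z, h w z = g w * (w - (z : ℂ))⁻¹ := fun w z => rfl
  have hhc : HasCompactSupport h := by
    refine (hasCompactSupport_dbar hφc).mono fun x hx h' => hx ?_
    ext z
    simp [happ, hg, h']
  have hint : Integrable h := h.continuous.integrable_of_hasCompactSupport hhc
  have hmem : ∀ w, h w ∈ ratSub K := by
    intro w
    by_cases hw : w ∈ K
    · have : h w = 0 := by
        ext z
        simp [happ, hg, (hd0 w hw).self_of_nhds]
      rw [this]
      exact zero_mem _
    · refine ⟨Polynomial.C (g w), Polynomial.C w - Polynomial.X, ?_, ?_⟩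
      · intro z hz h'
        simp [sub_eq_zero] at h'
        exact hw (h' ▸ hz)
      · intro z
        simp [happ, div_eq_mul_inv]
  have hI : ∫ w, h w ∈ (ratSub K).topologicalClosure := by
    have hcl : IsClosed ((ratSub K).topologicalClosure : Set C(K, ℂ)) :=
      (ratSub K).isClosed_topologicalClosure
    have := hcl
    by_contra hno
    obtain ⟨l, u, hl, hu⟩ := RCLike.geometric_hahn_banach_closed_point (𝕜 := ℂ)
      (((ratSub K).topologicalClosure.restrictScalars ℝ).convex) hcl hno
    have hl0 : ∀ a ∈ (ratSub K).topologicalClosure, l a = 0 := by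
      intro a ha
      by_contra hla
      have := hl ((((u + 1 : ℝ) : ℂ) * (l a)⁻¹) • a) (Submodule.smul_mem _ _ ha)
      rw [map_smul, smul_eq_mul, mul_assoc, inv_mul_cancel₀ hla] at this
      simp at this
      linarith
    have h0 := hl 0 (zero_mem _)
    have h1 : l (∫ w, h w) = 0 := by
      rw [← l.integral_comp_comm hint]
      simp [hl0 _ ((ratSub K).le_topologicalClosure (hmem _))]
    rw [h1] at hu
    simp at hu h0
    linarith
  have hval : ∫ w, h w = c • F := by
    ext z
    have e1 : (∫ w, h w) z = ∫ w, g w * (w - (z : ℂ))⁻¹ :=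
      ((ContinuousMap.evalCLM ℂ z).integral_comp_comm hint).symm
    rw [e1]
    have hzU : (z : ℂ) ∈ U := hKU z.2
    have e2 := integral_dbar_mul hU hφ hφc
      ((Complex.differentiableOn_dslope (hU.mem_nhds hzU)).2 hf) hφ0
    have e3 : ∀ w, dbar φ w * dslope f z w
        = g w * (w - (z : ℂ))⁻¹ - f z * (dbar φ w * (w - (z : ℂ))⁻¹) := by
      intro w
      by_cases hw : w = z
      · subst hw
        simp [hg, (hd0 _ z.2).self_of_nhds]
      · rw [dslope_of_ne _ hw, slope_def_field, hg]
        ring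
    simp_rw [e3] at e2
    have i1 : Integrable fun w => g w * (w - (z : ℂ))⁻¹ :=
      (ContinuousMap.evalCLM ℂ z).integrable_comp hint
    have i2 : Integrable fun w => dbar φ w * (w - (z : ℂ))⁻¹ := by
      refine integrable_dbar_mul (V := {(z : ℂ)}ᶜ) isOpen_compl_singleton hφ hφc ?_ ?_
      · exact ContinuousOn.inv₀ (by fun_prop) fun w hw => sub_ne_zero.2 hw
      · intro x hx
        obtain rfl : x = z := by simpa using hx
        exact hd0 _ z.2
    rw [integral_sub i1 (i2.const_mul _), integral_const_mul,
      hconst φ z hφ hφc (hφ1 _ z.2), sub_eq_zero] at e2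
    rw [e2]
    simp [hF, mul_comm]
  rw [hval] at hI
  have := Submodule.smul_mem _ c⁻¹ hI
  rwa [smul_smul, inv_mul_cancel₀ hc, one_smul] at this

end RandomRunge

/-- random Runge theorem, Theorem 2.1 of the paper.
Let `(Ω, 𝒜)` be a measurable space, `U ⊆ ℂ` open, and `f : Ω × U → ℂ` a random holomorphic
function (`f (ω, ·)` holomorphic on `U` for each `ω`, `f (·, z)` measurable for each `z ∈ U`).
Let `K ⊆ U` be compact. Then there is a sequence `R n` of random rational functions pole-free
on `K` converging, for each `ω`, uniformly on `K` to `f (ω, ·)`. -/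
theorem random_runge_open
    {Ω : Type*} [MeasurableSpace Ω] {U : Set ℂ} (hU : IsOpen U)
    (f : Ω → ℂ → ℂ)
    (hf_hol : ∀ ω, DifferentiableOn ℂ (f ω) U)
    (hf_meas : ∀ z ∈ U, Measurable fun ω => f ω z)
    {K : Set ℂ} (hK : IsCompact K) (hKU : K ⊆ U) :
    ∃ R : ℕ → Ω → ℂ → ℂ,
      (∀ n : ℕ,
        (∀ z ∈ K, Measurable fun ω => R n ω z) ∧
        (∀ ω : Ω, ∃ p q : Polynomial ℂ, (∀ z ∈ K, q.eval z ≠ 0) ∧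
          ∀ z ∈ K, R n ω z = p.eval z / q.eval z)) ∧
      (∀ ω : Ω, TendstoUniformlyOn (fun n => R n ω) (f ω) Filter.atTop K) := by
  classical
  have : CompactSpace K := isCompact_iff_compactSpace.1 hK
  let F : Ω → C(K, ℂ) := fun ω =>
    ⟨fun z => f ω z, ((hf_hol ω).continuousOn.mono hKU).domRestrict⟩
  have hFa : ∀ ω (z : K), F ω z = f ω z := fun _ _ => rfl
  have hF : ∀ ω, F ω ∈ closure (RandomRunge.ratSub K : Set C(K, ℂ)) := fun ω =>
    RandomRunge.runge hU hK hKU (hf_hol ω) (F ω) (hFa ω)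
  let d : ℕ → RandomRunge.ratSub K := TopologicalSpace.denseSeq _
  have hd : DenseRange d := TopologicalSpace.denseRange_denseSeq _
  obtain ⟨D, hDc, hDd⟩ := TopologicalSpace.exists_countable_dense K
  have hD : ∀ ω k (ε : ℝ), (∀ z ∈ D, ‖f ω z - (d k).1 z‖ ≤ ε) →
      ∀ z : K, ‖f ω z - (d k).1 z‖ ≤ ε := by
    intro ω k ε h
    have hcl : IsClosed {z : K | ‖F ω z - (d k).1 z‖ ≤ ε} :=
      isClosed_le (by fun_prop) continuous_const
    intro z
    exact closure_minimal (fun z hz => h z hz) hcl (hDd z)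
  let P : ℕ → Ω → ℕ → Prop := fun n ω k => ∀ z ∈ D, ‖f ω z - (d k).1 z‖ ≤ 1 / ((n : ℝ) + 1)
  have hP : ∀ n ω, ∃ k, P n ω k := by
    intro n ω
    have hε : (0 : ℝ) < 1 / ((n : ℝ) + 1) := by positivity
    obtain ⟨r, hr, hr'⟩ := Metric.mem_closure_iff.1 (hF ω) _ (half_pos hε)
    obtain ⟨k, hk⟩ := Metric.denseRange_iff.1 hd ⟨r, hr⟩ _ (half_pos hε)
    refine ⟨k, fun z _ => ?_⟩
    have h1 : dist (F ω) (d k).1 < 1 / ((n : ℝ) + 1) := by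
      have h2 : dist r (d k).1 < 1 / ((n : ℝ) + 1) / 2 := hk
      linarith [dist_triangle (F ω) r (d k).1]
    rw [← hFa, ← dist_eq_norm]
    exact (ContinuousMap.dist_apply_le_dist z).trans h1.le
  have hPm : ∀ n k, MeasurableSet {ω | P n ω k} := by
    intro n k
    have : {ω | P n ω k} = ⋂ z ∈ D, {ω | ‖f ω z - (d k).1 z‖ ≤ 1 / ((n : ℝ) + 1)} := by
      ext ω; simp [P]
    rw [this]
    refine MeasurableSet.biInter hDc fun z _ => ?_
    exact measurableSet_le (((hf_meas z (hKU z.2)).sub_const _).norm) measurable_const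
  refine ⟨fun n ω z => if hz : z ∈ K then (d (Nat.find (hP n ω))).1 ⟨z, hz⟩ else 0,
    fun n => ⟨?_, ?_⟩, ?_⟩
  · intro z hz
    simp only [hz, dif_pos]
    exact (measurable_from_top (f := fun k : ℕ => (d k).1 ⟨z, hz⟩)).comp
      (measurable_find (hP n) (hPm n))
  · intro ω
    obtain ⟨p, q, hq, hr⟩ := (d (Nat.find (hP n ω))).2
    exact ⟨p, q, hq, fun z hz => by simpa only [hz, dif_pos] using hr ⟨z, hz⟩⟩
  · intro ω
    rw [Metric.tendstoUniformlyOn_iff]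
    intro ε hε
    obtain ⟨N, hN⟩ := exists_nat_one_div_lt hε
    filter_upwards [Filter.eventually_ge_atTop N] with n hn z hz
    simp only [hz, dif_pos]
    rw [dist_eq_norm]
    refine (hD ω _ _ (Nat.find_spec (hP n ω)) ⟨z, hz⟩).trans_lt (lt_of_le_of_lt ?_ hN)
    exact one_div_le_one_div_of_le (by positivity) (by gcongr)
end

section
/- Let K ⊆ ℂ be a nonempty compact set, (Ω, 𝒜) a measurable space, and f : Ω × K → ℂ a function such that f(·,z) is measurable for each z ∈ K. Suppose that for each ω ∈ Ω there exist an open set U_ω ⊇ K and a function g_ω holomorphic on U_ω whose restriction to K equals f(ω,·). Then there exists a sequence r₁, r₂, … of random rational functions pole-free on K such that for each ω ∈ Ω the functions rⱼ(ω,·) converge to f(ω,·) uniformly on K. -/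
open MeasureTheory Set Filter Topology

/-- The Wirtinger derivative `∂h/∂z̄`. -/
noncomputable def rrDbar (h : ℂ → ℂ) (w : ℂ) : ℂ :=
  (fderiv ℝ h w 1 + Complex.I * fderiv ℝ h w Complex.I) / 2

lemma rr_alg (D : ℂ →L[ℝ] ℂ) (v : ℂ) :
    D v + Complex.I * D (Complex.I * v) =
      (starRingEnd ℂ) v * (D 1 + Complex.I * D Complex.I) := by
  have key : ∀ u : ℂ, D u = u.re * D 1 + u.im * D Complex.I := by
    intro u
    have : u = u.re • (1 : ℂ) + u.im • Complex.I := by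
      simp [Complex.re_add_im]
    conv_lhs => rw [this]
    rw [map_add, map_smul, map_smul]
    simp
  rw [key v, key (Complex.I * v)]
  have hv : (starRingEnd ℂ) v = v.re - v.im * Complex.I := by
    apply Complex.ext <;> simp
  rw [hv]
  simp
  ring_nf
  simp

/-- the Cauchy–Pompeiu formula for compactly supported functions. -/
lemma rr_pompeiu (h : ℂ → ℂ) (hh : ContDiff ℝ 1 h) (hc : HasCompactSupport h) (z : ℂ) :
    ∫ w, rrDbar h w / (w - z) = -Real.pi * h z := by
  -- polar parametrization
  set e : ℝ → ℂ := fun θ => Complex.exp (θ * Complex.I) with he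
  have hecont : Continuous e := by fun_prop
  have hnorm : ∀ θ, ‖e θ‖ = 1 := fun θ => Complex.norm_exp_ofReal_mul_I θ
  have hfd : Continuous (fderiv ℝ h) := hh.continuous_fderiv one_ne_zero
  obtain ⟨R, hR⟩ : ∃ R : ℝ, ∀ w, R < ‖w - z‖ → fderiv ℝ h w = 0 ∧ h w = 0 := by
    obtain ⟨R, hR⟩ := hc.isCompact.isBounded.subset_closedBall z
    refine ⟨R, fun w hw => ?_⟩
    have : w ∉ tsupport h := fun hw' => by
      have := hR hw'
      rw [Metric.mem_closedBall, dist_eq_norm] at this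
      linarith
    exact ⟨image_eq_zero_of_notMem_tsupport (fun h' => this (tsupport_fderiv_subset ℝ h')),
      image_eq_zero_of_notMem_tsupport this⟩
  set A : ℝ × ℝ → ℂ := fun p => fderiv ℝ h (z + p.1 * e p.2) (e p.2) with hA
  set B : ℝ × ℝ → ℂ := fun p => fderiv ℝ h (z + p.1 * e p.2) (Complex.I * e p.2) with hB
  set T : Set (ℝ × ℝ) := Ioi (0 : ℝ) ×ˢ Ioo (-Real.pi) Real.pi with hT
  have hAc : Continuous A := by fun_prop
  have hBc : Continuous B := by fun_prop
  have hzero : ∀ p : ℝ × ℝ, R < p.1 → fderiv ℝ h (z + p.1 * e p.2) = 0 := by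
    intro p hp
    refine (hR _ ?_).1
    simpa [hnorm] using hp.trans_le (le_abs_self _)
  have hInt : ∀ F : ℝ × ℝ → ℂ, Continuous F → (∀ p : ℝ × ℝ, R < p.1 → F p = 0) →
      IntegrableOn F T := by
    intro F hF h0
    have h1 : IntegrableOn F (Icc 0 R ×ˢ Icc (-Real.pi) Real.pi) :=
      hF.continuousOn.integrableOn_compact (isCompact_Icc.prod isCompact_Icc)
    refine (h1.of_forall_sdiff_eq_zero (t := T) (measurableSet_Ioi.prod measurableSet_Ioo) ?_)
    rintro ⟨r, θ⟩ ⟨⟨h2, h3⟩, h4⟩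
    apply h0
    by_contra h5
    exact h4 ⟨⟨le_of_lt h2, not_lt.1 h5⟩, Ioo_subset_Icc_self h3⟩
  have hAi : IntegrableOn A T := hInt A hAc fun p hp => by simp [hA, hzero p hp]
  have hBi : IntegrableOn B T := hInt B hBc fun p hp => by simp [hB, hzero p hp]
  have hAint : ∫ p in T, A p = -(2 * Real.pi) * h z := by
    have : ∀ θ : ℝ, ∫ r in Ioi (0:ℝ), A (r, θ) = - h z := by
      intro θ
      have hφ : ContDiff ℝ 1 (fun r : ℝ => h (z + r * e θ)) := by
        apply hh.comp
        have : ContDiff ℝ 1 (fun r : ℝ => (r : ℂ)) := Complex.ofRealCLM.contDiff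
        fun_prop
      have hφc : HasCompactSupport (fun r : ℝ => h (z + r * e θ)) := by
        refine HasCompactSupport.of_support_subset_isCompact (isCompact_Icc (a := -R) (b := R)) ?_
        intro r hr
        by_contra h'
        apply hr
        refine (hR _ ?_).2
        rw [mem_Icc, ← abs_le, not_le] at h'
        simpa [hnorm] using h'
      have := hφc.integral_Ioi_deriv_eq hφ 0
      simp only [Complex.ofReal_zero, zero_mul, add_zero] at this
      rw [← this]
      congr 1
      ext r
      have h1 : HasDerivAt (fun r : ℝ => z + r * e θ) (e θ) r := by
        simpa using ((Complex.ofRealCLM.hasDerivAt (x := r)).mul_const (e θ)).const_add z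
      exact ((hh.differentiable one_ne_zero _).hasFDerivAt.comp_hasDerivAt r h1).deriv.symm
    rw [hT, Measure.volume_eq_prod, ← Measure.prod_restrict, integral_prod_symm]
    · simp only [this]
      simp
      left
      rw [max_eq_left (by positivity)]
      push_cast
      ring
    · rw [Measure.prod_restrict]
      exact hAi
  have hBint : ∫ p in T, B p = 0 := by
    rw [hT, Measure.volume_eq_prod, setIntegral_prod]
    swap
    · exact hBi
    apply setIntegral_eq_zero_of_forall_eq_zero
    intro r hr
    have hr0 : (r : ℂ) ≠ 0 := by exact_mod_cast (ne_of_gt hr)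
    have hd : ∀ θ : ℝ, HasDerivAt (fun θ : ℝ => h (z + r * e θ)) (r * B (r, θ)) θ := by
      intro θ
      have h0 : HasDerivAt e (Complex.I * e θ) θ := by
        have := ((Complex.ofRealCLM.hasDerivAt (x := θ)).mul_const Complex.I).cexp
        simpa [he, mul_comm] using this
      have h1 : HasDerivAt (fun θ : ℝ => z + r * e θ) (r * (Complex.I * e θ)) θ :=
        (h0.const_mul (r : ℂ)).const_add z
      have h2 := (hh.differentiable one_ne_zero _).hasFDerivAt.comp_hasDerivAt θ h1
      rw [← Complex.real_smul (x := r) (z := Complex.I * e θ), map_smul, Complex.real_smul] at h2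
      exact h2
    have h3 : ∫ θ in (-Real.pi)..Real.pi, r * B (r, θ) = 0 := by
      rw [intervalIntegral.integral_eq_sub_of_hasDerivAt (fun θ _ => hd θ)
        (Continuous.intervalIntegrable (by fun_prop) _ _)]
      simp [he, Complex.exp_neg]
    rw [intervalIntegral.integral_const_mul] at h3
    have h4 := (mul_eq_zero.1 h3).resolve_left hr0
    rwa [intervalIntegral.integral_of_le (by linarith [Real.pi_pos]),
      integral_Ioc_eq_integral_Ioo] at h4
  have h1 : ∫ w, rrDbar h w / (w - z) = ∫ u, rrDbar h (z + u) / u := by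
    rw [← integral_add_left_eq_self _ z]
    simp
  rw [h1, ← Complex.integral_comp_polarCoord_symm]
  have h2 : ∀ p ∈ T, p.1 • (rrDbar h (z + Complex.polarCoord.symm p) / Complex.polarCoord.symm p)
      = (A p + Complex.I * B p) / 2 := by
    intro p hp
    have hp0 : (p.1 : ℂ) ≠ 0 := by exact_mod_cast (ne_of_gt hp.1)
    have hs : Complex.polarCoord.symm p = p.1 * e p.2 := by
      rw [Complex.polarCoord_symm_apply, he]
      simp [Complex.exp_mul_I]
    have he0 : e p.2 ≠ 0 := Complex.exp_ne_zero _
    have hcj : (starRingEnd ℂ) (e p.2) * e p.2 = 1 := by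
      rw [mul_comm, Complex.mul_conj, Complex.normSq_eq_norm_sq, hnorm]; simp
    rw [hs, hA, hB]
    simp only
    rw [rr_alg, rrDbar, Complex.real_smul]
    field_simp
    linear_combination (-(fderiv ℝ h (z + p.1 * e p.2) 1 +
      Complex.I * fderiv ℝ h (z + p.1 * e p.2) Complex.I)) * hcj
  have hTm : MeasurableSet T := measurableSet_Ioi.prod measurableSet_Ioo
  change ∫ p in T, _ = _
  rw [setIntegral_congr_fun hTm h2, integral_div, integral_add hAi (hBi.const_mul _),
    integral_const_mul, hAint, hBint]
  ring

/-- rational functions pole-free on `K`, as a subspace of `C(K, ℂ)`. -/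
noncomputable def rrRat (K : Set ℂ) : Submodule ℂ C(K, ℂ) where
  carrier := {F | ∃ p q : Polynomial ℂ, (∀ z ∈ K, q.eval z ≠ 0) ∧
    ∀ z : K, F z = p.eval (z : ℂ) / q.eval (z : ℂ)}
  zero_mem' := ⟨0, 1, by simp, by simp⟩
  add_mem' := by
    rintro F G ⟨p, q, h1, h2⟩ ⟨pb, qb, h1b, h2b⟩
    refine ⟨p * qb + q * pb, q * qb, fun z hz => by simp [h1 z hz, h1b z hz], fun z => ?_⟩
    simp [h2, h2b, div_add_div _ _ (h1 z z.2) (h1b z z.2)]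
  smul_mem' := by
    rintro c F ⟨p, q, h1, h2⟩
    exact ⟨Polynomial.C c * p, q, h1, fun z => by simp [h2, mul_div_assoc]⟩

lemma rr_integral_mem {E : Type*} [NormedAddCommGroup E] [NormedSpace ℂ E] [CompleteSpace E]
    (S : Submodule ℂ E) (hS : IsClosed (S : Set E)) {X : Type*} [MeasurableSpace X]
    (μ : Measure X) (F : X → E) (hF : Integrable F μ) (hm : ∀ x, F x ∈ S) :
    ∫ x, F x ∂μ ∈ S := by
  by_contra hx
  obtain ⟨L, u, h1, h2⟩ := RCLike.geometric_hahn_banach_closed_point (𝕜 := ℂ)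
    (S.restrictScalars ℝ).convex hS hx
  have hL : ∀ a ∈ S, L a = 0 := by
    intro a ha
    by_contra hne
    have := h1 (((u + 1 : ℝ) / L a : ℂ) • a) (S.smul_mem _ ha)
    rw [map_smul, smul_eq_mul, div_mul_cancel₀ _ hne] at this
    simp at this
    linarith
  have h0 := h1 0 S.zero_mem
  rw [← L.integral_comp_comm hF] at h2
  simp [hL _ (hm _)] at h2 h0
  linarith

lemma rr_runge {K U : Set ℂ} (hK : IsCompact K) (hU : IsOpen U) (hKU : K ⊆ U) (g : ℂ → ℂ)
    (hg : DifferentiableOn ℂ g U) (F : C(K, ℂ)) (hF : ∀ z : K, F z = g z) :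
    F ∈ closure (rrRat K : Set C(K, ℂ)) := by
  have : CompactSpace K := isCompact_iff_compactSpace.1 hK
  obtain ⟨L, hL, hKL, hLU⟩ := exists_compact_between hK hU hKU
  obtain ⟨χ, hχ1, hχ0, -⟩ := exists_contMDiffMap_one_nhds_of_subset_interior
    (n := 1) (modelWithCornersSelf ℝ ℂ) hK.isClosed hKL
  have hχs : ContDiff ℝ 1 χ := χ.contMDiff.contDiff
  have hχt : tsupport χ ⊆ L := by
    apply closure_minimal _ hL.isClosed
    intro x hx
    by_contra h'
    exact hx (hχ0 x h')
  set h : ℂ → ℂ := fun w => (χ w : ℂ) * g w with hh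
  have hts : tsupport h ⊆ tsupport χ := by
    apply closure_mono
    intro x hx hx'
    exact hx (by simp [hh, hx'])
  have hgc : ∀ x ∈ U, ContDiffAt ℝ 1 g x := fun x hx =>
    ((hg.analyticOnNhd hU x hx).contDiffAt (n := 1)).restrict_scalars ℝ
  have hhs : ContDiff ℝ 1 h := by
    rw [contDiff_iff_contDiffAt]
    intro x
    by_cases hx : x ∈ tsupport χ
    · have h1 : ContDiff ℝ 1 (fun w => (χ w : ℂ)) := Complex.ofRealCLM.contDiff.comp hχs
      exact h1.contDiffAt.mul (hgc x (hLU (hχt hx)))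
    · have : h =ᶠ[𝓝 x] fun _ => 0 :=
        notMem_tsupport_iff_eventuallyEq.1 (fun h' => hx (hts h'))
      exact contDiffAt_const.congr_of_eventuallyEq this
  have hhc : HasCompactSupport h :=
    hL.of_isClosed_subset (isClosed_tsupport _) (hts.trans hχt)
  have hfd : Continuous (fderiv ℝ h) := hhs.continuous_fderiv one_ne_zero
  have hdc : Continuous (rrDbar h) := by unfold rrDbar; fun_prop
  have hd0 : ∀ z ∈ K, rrDbar h =ᶠ[𝓝 z] fun _ => 0 := by
    intro z hz
    have h1 : ∀ᶠ w in 𝓝 z, χ w = 1 := (eventually_nhdsSet_iff_forall.1 hχ1) z hz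
    have h2 : ∀ᶠ w in 𝓝 z, h =ᶠ[𝓝 w] g := by
      apply Eventually.eventually_nhds
      filter_upwards [h1] with w hw
      simp [hh, hw]
    filter_upwards [h2, hU.mem_nhds (hKU hz)] with w hw hwU
    have h3 : HasFDerivAt h ((fderiv ℂ g w).restrictScalars ℝ) w :=
      (((hg.differentiableAt (hU.mem_nhds hwU)).hasFDerivAt).restrictScalars ℝ).congr_of_eventuallyEq hw
    rw [rrDbar, h3.fderiv]
    have : fderiv ℂ g w Complex.I = Complex.I * fderiv ℂ g w 1 := by
      rw [← smul_eq_mul, ← map_smul]; simp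
    simp [this, ← mul_assoc]
  have hjc : Continuous (fun p : ℂ × K => rrDbar h p.1 / (p.1 - p.2)) := by
    rw [continuous_iff_continuousAt]
    rintro ⟨w, z⟩
    by_cases hwz : w = z
    · have : (fun p : ℂ × K => rrDbar h p.1 / (p.1 - p.2)) =ᶠ[𝓝 (w, z)] fun _ => 0 := by
        have := ((continuous_fst (X := ℂ) (Y := K)).tendsto (w, z)).eventually
          (show ∀ᶠ y in 𝓝 w, rrDbar h y = 0 by rw [hwz]; exact hd0 z z.2)
        filter_upwards [this] with p hp
        simp [hp]
      exact continuousAt_const.congr this.symm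
    · apply ContinuousAt.div
      · fun_prop
      · fun_prop
      · exact sub_ne_zero.2 hwz
  set Φ : C(ℂ, C(K, ℂ)) := ContinuousMap.curry ⟨_, hjc⟩ with hΦ
  have hΦa : ∀ w (z : K), Φ w z = rrDbar h w / (w - z) := fun w z => rfl
  have hΦs : HasCompactSupport Φ := by
    refine HasCompactSupport.of_support_subset_isCompact hhc.isCompact ?_
    intro w hw
    by_contra h'
    apply hw
    ext z
    rw [hΦa, rrDbar, image_eq_zero_of_notMem_tsupport
      (fun hw2 => h' (tsupport_fderiv_subset ℝ hw2))]
    simp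
  have hΦi : Integrable Φ := Φ.continuous.integrable_of_hasCompactSupport hΦs
  have hΦm : ∀ w, Φ w ∈ (rrRat K).topologicalClosure := by
    intro w
    apply Submodule.le_topologicalClosure
    by_cases hw : w ∈ K
    · convert (rrRat K).zero_mem
      ext z
      rw [hΦa, (hd0 w hw).self_of_nhds]
      simp
    · refine ⟨Polynomial.C (rrDbar h w), Polynomial.C w - Polynomial.X, ?_, ?_⟩
      · intro z hz h0
        simp [sub_eq_zero] at h0
        exact hw (h0 ▸ hz)
      · intro z
        simp [hΦa]
  have hmem := rr_integral_mem _ (rrRat K).isClosed_topologicalClosure volume Φ hΦi hΦm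
  have hfin : F = (-(Real.pi : ℂ)⁻¹) • ∫ w, Φ w := by
    ext z
    rw [ContinuousMap.smul_apply, ContinuousMap.integral_apply hΦi]
    simp only [hΦa]
    rw [rr_pompeiu h hhs hhc]
    have h1 : χ z = 1 := hχ1.self_of_nhdsSet z z.2
    have hpi : (Real.pi : ℂ) ≠ 0 := by exact_mod_cast Real.pi_ne_zero
    simp [hF, hh, h1, hpi]
  rw [hfin]
  exact (rrRat K).topologicalClosure.smul_mem _ hmem

/-- Theorem `conjRunge` of the paper. Let `K ⊆ ℂ` be a nonempty compact set,
`(Ω, 𝒜)` a measurable space, and `f : Ω × K → ℂ` a random function such that for each `ω` the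
function `f (ω, ·)` is the restriction to `K` of a function holomorphic on some open
neighborhood of `K`. Then there is a sequence of random rational functions pole-free on `K`
converging, for each `ω`, uniformly on `K` to `f (ω, ·)`. -/
theorem random_runge_compact
    {Ω : Type*} [MeasurableSpace Ω] {K : Set ℂ} (hK : IsCompact K) (hKne : K.Nonempty)
    (f : Ω → ℂ → ℂ)
    (hf_meas : ∀ z ∈ K, Measurable fun ω => f ω z)
    (hf_ext : ∀ ω : Ω, ∃ U : Set ℂ, IsOpen U ∧ K ⊆ U ∧
      ∃ g : ℂ → ℂ, DifferentiableOn ℂ g U ∧ ∀ z ∈ K, g z = f ω z) :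
    ∃ r : ℕ → Ω → ℂ → ℂ,
      (∀ j : ℕ,
        (∀ z ∈ K, Measurable fun ω => r j ω z) ∧
        (∀ ω : Ω, ∃ p q : Polynomial ℂ, (∀ z ∈ K, q.eval z ≠ 0) ∧
          ∀ z ∈ K, r j ω z = p.eval z / q.eval z)) ∧
      (∀ ω : Ω, TendstoUniformlyOn (fun j => r j ω) (f ω) Filter.atTop K) := by
  classical
  have : CompactSpace K := isCompact_iff_compactSpace.1 hK
  have : Nonempty K := hKne.to_subtype
  -- a countable dense family of rational functions
  set D : ℕ → rrRat K := TopologicalSpace.denseSeq (rrRat K) with hD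
  have hDd : DenseRange D := TopologicalSpace.denseRange_denseSeq _
  choose p q hq hpq using fun n => (D n).2
  set d : ℕ → K := TopologicalSpace.denseSeq K with hd
  have hdd : DenseRange d := TopologicalSpace.denseRange_denseSeq _
  have hfc : ∀ ω, ∃ F : C(K, ℂ), ∀ z : K, F z = f ω z := by
    intro ω
    obtain ⟨U, hU, hKU, g, hg, hgf⟩ := hf_ext ω
    refine ⟨⟨fun z => f ω z, ?_⟩, fun z => rfl⟩
    have : ContinuousOn (f ω) K := (hg.continuousOn.mono hKU).congr fun z hz => (hgf z hz).symm
    exact this.domRestrict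
  choose F hF using hfc
  have hFcl : ∀ ω, F ω ∈ closure (rrRat K : Set C(K, ℂ)) := by
    intro ω
    obtain ⟨U, hU, hKU, g, hg, hgf⟩ := hf_ext ω
    exact rr_runge hK hU hKU g hg _ fun z => by rw [hF, hgf z z.2]
  -- measurable goodness condition
  let P : ℕ → Ω → ℕ → Prop := fun j ω n => ∀ k, ‖f ω (d k) - (D n : C(K, ℂ)) (d k)‖ ≤ 1 / ((j : ℝ) + 1)
  have hP : ∀ j ω, ∃ n, P j ω n := by
    intro j ω
    have hε : (0 : ℝ) < 1 / ((j : ℝ) + 1) := by positivity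
    obtain ⟨G, hG, hGd⟩ := Metric.mem_closure_iff.1 (hFcl ω) _ (half_pos hε)
    obtain ⟨n, hn⟩ := hDd.exists_dist_lt ⟨G, hG⟩ (half_pos hε)
    refine ⟨n, fun k => ?_⟩
    rw [← hF, ← dist_eq_norm]
    refine (ContinuousMap.dist_apply_le_dist _).trans ?_
    have h1 : dist G (D n : C(K, ℂ)) < 1 / ((j : ℝ) + 1) / 2 := hn
    have := dist_triangle (F ω) G (D n : C(K, ℂ))
    linarith
  have hPu : ∀ j ω n, P j ω n → ∀ z : K, ‖f ω z - (D n : C(K, ℂ)) z‖ ≤ 1 / ((j : ℝ) + 1) := by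
    intro j ω n h z
    rw [← hF]
    refine hdd.induction_on (p := fun z => ‖F ω z - (D n : C(K, ℂ)) z‖ ≤ 1 / ((j : ℝ) + 1)) z ?_ ?_
    · exact isClosed_le (by fun_prop) continuous_const
    · intro k
      rw [hF]
      exact h k
  have hPm : ∀ j n, MeasurableSet {ω | P j ω n} := by
    intro j n
    simp only [P, ofPred_forall]
    refine MeasurableSet.iInter fun k => ?_
    exact measurableSet_le (((hf_meas _ (d k).2).sub_const _).norm) measurable_const
  have hNm : ∀ j, Measurable fun ω => Nat.find (hP j ω) := fun j =>
    measurable_find _ (hPm j)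
  refine ⟨fun j ω z => (p (Nat.find (hP j ω))).eval z / (q (Nat.find (hP j ω))).eval z,
    fun j => ⟨fun z hz => ?_, fun ω => ⟨_, _, hq _, fun z hz => rfl⟩⟩, fun ω => ?_⟩
  · exact (measurable_from_nat (f := fun n => (p n).eval z / (q n).eval z)).comp (hNm j)
  · rw [Metric.tendstoUniformlyOn_iff]
    intro ε hε
    obtain ⟨N, hN⟩ := exists_nat_one_div_lt hε
    filter_upwards [eventually_ge_atTop N] with j hj z hz
    have h1 := hPu j ω _ (Nat.find_spec (hP j ω)) ⟨z, hz⟩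
    rw [hpq] at h1
    rw [dist_eq_norm]
    exact (h1.trans (Nat.one_div_le_one_div hj)).trans_lt hN
end

section
/- Let K ⊆ ℂ be a nonempty compact set, (Ω, 𝒜) a measurable space, and f : Ω × K → ℂ a function such that f(·,z) is measurable for each z ∈ K and, for each ω ∈ Ω, f(ω,·) is the restriction to K of a function holomorphic on some open neighborhood U_ω of K. Then there exists a sequence r₁, r₂, … of random rational functions pole-free on K such that rⱼ → f uniformly on Ω × K, i.e., sup_{(ω,z) ∈ Ω × K} |rⱼ(ω,z) − f(ω,z)| → 0. -/
open Filter Topology MeasureTheory Complex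

/-- Twice the `∂̄`-derivative. -/
noncomputable def dbar2 (G : ℂ → ℂ) (w : ℂ) : ℂ := fderiv ℝ G w 1 + I * fderiv ℝ G w I

lemma dbar2_rot (G : ℂ → ℂ) (w e : ℂ) :
    dbar2 G w * (starRingEnd ℂ) e = fderiv ℝ G w e + I * fderiv ℝ G w (I * e) := by
  have h (u : ℂ) : fderiv ℝ G w u = u.re * fderiv ℝ G w 1 + u.im * fderiv ℝ G w I := by
    have hu : u = u.re • (1 : ℂ) + u.im • I := by
      apply Complex.ext <;> simp
    conv_lhs => rw [hu]
    rw [map_add, map_smul, map_smul]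
    simp
  rw [h e, h (I * e), dbar2]
  have : (starRingEnd ℂ) e = e.re - e.im * I := by
    apply Complex.ext <;> simp
  rw [this]
  simp
  linear_combination (-(e.im : ℂ) * fderiv ℝ G w I) * Complex.I_sq

lemma hasDerivAt_radial {G : ℂ → ℂ} (hG : Differentiable ℝ G) (z e : ℂ) (r : ℝ) :
    HasDerivAt (fun r : ℝ => G (z + r * e)) (fderiv ℝ G (z + r * e) e) r := by
  have h1 : HasDerivAt (fun r : ℝ => z + r * e) e r := by
    simpa using ((Complex.ofRealCLM.hasDerivAt (x := r)).mul_const e).const_add z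
  exact (hG _).hasFDerivAt.comp_hasDerivAt r h1

lemma hasDerivAt_angular {G : ℂ → ℂ} (hG : Differentiable ℝ G) (z : ℂ) (r t : ℝ) :
    HasDerivAt (fun t : ℝ => G (z + r * exp (t * I)))
      (r * fderiv ℝ G (z + r * exp (t * I)) (I * exp (t * I))) t := by
  have h0 : HasDerivAt (fun t : ℝ => exp (t * I)) (I * exp (t * I)) t := by
    have := ((Complex.ofRealCLM.hasDerivAt (x := t)).mul_const I).cexp
    simpa [mul_comm] using this
  have h1 : HasDerivAt (fun t : ℝ => z + r * exp (t * I)) (r * (I * exp (t * I))) t := 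
    (h0.const_mul _).const_add z
  have := (hG _).hasFDerivAt.comp_hasDerivAt t h1
  have h2 : (r : ℂ) * (I * exp (t * I)) = r • (I * exp (t * I)) := Complex.real_smul.symm
  rw [h2, map_smul, Complex.real_smul] at this
  exact this

lemma cauchy_pompeiu {G : ℂ → ℂ} (hG : ContDiff ℝ 1 G) (hc : HasCompactSupport G) (z : ℂ) :
    ∫ w, dbar2 G w / (w - z) = - (2 * Real.pi) * G z := by
  have hd : Differentiable ℝ G := hG.differentiable one_ne_zero
  have hcont : Continuous (fderiv ℝ G) := hG.continuous_fderiv one_ne_zero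
  obtain ⟨R, hR⟩ : ∃ R : ℝ, ∀ w, R ≤ ‖w‖ → G (z + w) = 0 ∧ fderiv ℝ G (z + w) = 0 := by
    obtain ⟨M, hM⟩ := hc.isCompact.isBounded.exists_norm_le
    refine ⟨M + ‖z‖ + 1, fun w hw => ?_⟩
    have hn : z + w ∉ tsupport G := by
      intro h
      have h1 := hM _ h
      have h2 : ‖w‖ ≤ ‖z + w‖ + ‖z‖ := by
        simpa using norm_sub_le (z + w) z
      linarith
    exact ⟨image_eq_zero_of_notMem_tsupport hn,
      image_eq_zero_of_notMem_tsupport (fun h => hn (tsupport_fderiv_subset ℝ h))⟩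
  have hnorm (r t : ℝ) (hr : 0 ≤ r) : ‖(r : ℂ) * exp (t * I)‖ = r := by
    rw [norm_mul, Complex.norm_exp_ofReal_mul_I, mul_one, Complex.norm_real, Real.norm_of_nonneg hr]
  rw [← integral_add_left_eq_self _ z, ← Complex.integral_comp_polarCoord_symm]
  have key : ∀ p ∈ polarCoord.target,
      p.1 • (dbar2 G (z + Complex.polarCoord.symm p) / (z + Complex.polarCoord.symm p - z)) =
        fderiv ℝ G (z + p.1 * exp (p.2 * I)) (exp (p.2 * I)) +
        I * fderiv ℝ G (z + p.1 * exp (p.2 * I)) (I * exp (p.2 * I)) := by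
    intro p hp
    have hp1 : (p.1 : ℂ) ≠ 0 := by
      have : 0 < p.1 := hp.1
      exact_mod_cast this.ne'
    rw [← dbar2_rot, Complex.polarCoord_symm_apply, Complex.exp_mul_I, Complex.real_smul]
    have hs : (Complex.cos p.2 + Complex.sin p.2 * I) * 
       (starRingEnd ℂ) (Complex.cos p.2 + Complex.sin p.2 * I) = 1 := by
      rw [← Complex.exp_mul_I, Complex.mul_conj, Complex.normSq_eq_norm_sq, 
        Complex.norm_exp_ofReal_mul_I]
      simp
    have hne := left_ne_zero_of_mul_eq_one hs
    push_cast
    rw [add_sub_cancel_left]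
    field_simp
    rw [mul_right_comm, hs, one_mul]
  have hint (u : ℂ → ℂ) (hu : Continuous u) : IntegrableOn
      (fun p : ℝ × ℝ => fderiv ℝ G (z + p.1 * exp (p.2 * I)) (u (exp (p.2 * I))))
      (Set.Ioi 0 ×ˢ Set.Ioo (-Real.pi) Real.pi) (volume.prod volume) := by
    have hcc : Continuous 
      (fun p : ℝ × ℝ => fderiv ℝ G (z + p.1 * exp (p.2 * I)) (u (exp (p.2 * I)))) := by
      apply Continuous.clm_apply
      · exact hcont.comp (by fun_prop)
      · exact hu.comp (by fun_prop)
    have h1 : IntegrableOn _ (Set.Icc 0 R ×ˢ Set.Icc (-Real.pi) Real.pi) (volume.prod volume) :=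
      hcc.continuousOn.integrableOn_compact (isCompact_Icc.prod isCompact_Icc)
    refine h1.of_forall_sdiff_eq_zero (measurableSet_Ioi.prod measurableSet_Ioo) ?_
    rintro ⟨r, t⟩ ⟨⟨h1, h2⟩, h3⟩
    have hr : R ≤ r := by
      by_contra! h
      exact h3 ⟨⟨le_of_lt h1, h.le⟩, ⟨h2.1.le, h2.2.le⟩⟩
    simp [(hR (r * exp (t * I)) (by rw [hnorm r t (le_of_lt h1)]; exact hr)).2]
  have hi1 := hint id continuous_id
  have hi2 := hint (fun x => I * x) (by fun_prop)
  simp only [id] at hi1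
  have hswap : (∫ p in Set.Ioi (0:ℝ) ×ˢ Set.Ioo (-Real.pi) Real.pi,
      fderiv ℝ G (z + p.1 * exp (p.2 * I)) (exp (p.2 * I)) ∂(volume.prod volume)) =
      ∫ t in Set.Ioo (-Real.pi) Real.pi, ∫ r in Set.Ioi (0:ℝ),
        fderiv ℝ G (z + r * exp (t * I)) (exp (t * I)) := by
    rw [IntegrableOn, ← Measure.prod_restrict] at hi1
    rw [← Measure.prod_restrict]
    exact integral_prod_symm _ hi1
  rw [setIntegral_congr_fun polarCoord.open_target.measurableSet key, polarCoord_target,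
    Measure.volume_eq_prod, integral_add hi1 (hi2.const_mul I), integral_const_mul,
    setIntegral_prod _ hi2, hswap]
  have e2 : ∀ r ∈ Set.Ioi (0:ℝ), (∫ t in Set.Ioo (-Real.pi) Real.pi, 
      fderiv ℝ G (z + r * exp (t * I)) (I * exp (t * I))) = 0 := by
    intro r hr
    have hr0 : (r : ℂ) ≠ 0 := by exact_mod_cast (ne_of_gt hr)
    apply (mul_eq_zero.1 _).resolve_left hr0
    rw [← integral_const_mul, ← integral_Ioc_eq_integral_Ioo,
      ← intervalIntegral.integral_of_le (by linarith [Real.pi_pos]),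
      intervalIntegral.integral_eq_sub_of_hasDerivAt (fun t _ => hasDerivAt_angular hd z r t)]
    · simp [Complex.exp_neg]
    · apply Continuous.intervalIntegrable
      apply continuous_const.mul
      apply Continuous.clm_apply
      · exact hcont.comp (by fun_prop)
      · fun_prop
  have e1 : ∀ t ∈ Set.Ioo (-Real.pi) Real.pi, (∫ r in Set.Ioi (0:ℝ), 
      fderiv ℝ G (z + r * exp (t * I)) (exp (t * I))) = - G z := by
    intro t _
    rw [integral_Ioi_of_hasDerivAt_of_tendsto' (f := fun r : ℝ => G (z + r * exp (t * I))) (m := 0)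
      (fun r _ => hasDerivAt_radial hd z _ r)]
    · simp
    · have hcc : Continuous (fun r : ℝ => fderiv ℝ G (z + r * exp (t * I)) (exp (t * I))) := 
        (hcont.comp (by fun_prop)).clm_apply continuous_const
      refine (hcc.continuousOn.integrableOn_compact (isCompact_Icc (a := 0) (b := R))).of_forall_sdiff_eq_zero 
        measurableSet_Ioi ?_
      rintro r ⟨h1, h3⟩
      have hr : R ≤ r := by
        by_contra! h
        exact h3 ⟨le_of_lt h1, h.le⟩
      simp [(hR (r * exp (t * I)) (by rw [hnorm r t (le_of_lt h1)]; exact hr)).2]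
    · apply tendsto_const_nhds.congr'
      filter_upwards [eventually_ge_atTop R, eventually_ge_atTop 0] with r hr h0
      rw [(hR (r * exp (t * I)) (by rw [hnorm r t h0]; exact hr)).1]
  rw [setIntegral_congr_fun measurableSet_Ioi e2]
  simp only [integral_zero, mul_zero, add_zero]
  rw [setIntegral_congr_fun measurableSet_Ioo e1]
  simp
  left
  rw [max_eq_left (by linarith [Real.pi_pos])]
  push_cast
  ring

lemma dbar2_of_differentiableAt {G : ℂ → ℂ} {w : ℂ} (h : DifferentiableAt ℂ G w) :
    dbar2 G w = 0 := by
  rw [dbar2, h.fderiv_restrictScalars ℝ]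
  simp only [ContinuousLinearMap.coe_restrictScalars']
  have : fderiv ℂ G w I = I * fderiv ℂ G w 1 := by
    rw [← smul_eq_mul, ← map_smul, smul_eq_mul, mul_one]
  rw [this, ← mul_assoc, Complex.I_mul_I]
  ring

/-- Rational functions pole-free on `K`. -/
def ratSub (K : Set ℂ) : Submodule ℂ C(K, ℂ) where
  carrier := {h | ∃ p q : Polynomial ℂ, (∀ z ∈ K, q.eval z ≠ 0) ∧
    ∀ z : K, h z = p.eval (z : ℂ) / q.eval (z : ℂ)}
  zero_mem' := ⟨0, 1, by simp, by simp⟩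
  add_mem' := by
    rintro a b ⟨p, q, hq, h⟩ ⟨p2, q2, hq2, h2⟩
    refine ⟨p * q2 + q * p2, q * q2, fun z hz => ?_, fun z => ?_⟩
    · simpa using ⟨hq z hz, hq2 z hz⟩
    · rw [ContinuousMap.add_apply, h, h2, div_add_div _ _ (hq z z.2) (hq2 z z.2)]
      simp
  smul_mem' := by
    rintro c a ⟨p, q, hq, h⟩
    refine ⟨Polynomial.C c * p, q, hq, fun z => ?_⟩
    rw [ContinuousMap.smul_apply, h]
    simp [mul_div_assoc]

/-- The Runge theorem. -/
lemma runge {K : Set ℂ} (hK : IsCompact K) {U : Set ℂ} (hU : IsOpen U) (hKU : K ⊆ U)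
    {g : ℂ → ℂ} (hg : DifferentiableOn ℂ g U) (F : C(K, ℂ)) (hF : ∀ z : K, F z = g z) :
    F ∈ (ratSub K).topologicalClosure := by
  have : CompactSpace K := isCompact_iff_compactSpace.1 hK
  obtain ⟨T, hT, hKT, hTU⟩ := exists_compact_between hK hU hKU
  obtain ⟨φ, hφ1, hφ0, -⟩ := exists_contMDiffMap_one_nhds_of_subset_interior
    (n := 1) (modelWithCornersSelf ℝ ℂ) hK.isClosed hKT
  have hφ : ContDiff ℝ 1 φ := φ.contMDiff.contDiff
  set G : ℂ → ℂ := fun w => (φ w : ℂ) * g w with hGdef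
  have hGz : ∀ w ∉ T, G w = 0 := fun w hw => by simp [hGdef, hφ0 w hw]
  have hc : HasCompactSupport G := HasCompactSupport.intro hT hGz
  have hG : ContDiff ℝ 1 G := by
    rw [contDiff_iff_contDiffAt]
    intro w
    by_cases hw : w ∈ U
    · apply ContDiffAt.mul
      · exact (Complex.ofRealCLM.contDiff.comp hφ).contDiffAt
      · have := (hg.analyticAt (hU.mem_nhds hw)).contDiffAt (n := 1)
        exact this.restrict_scalars ℝ
    · have : G =ᶠ[𝓝 w] fun _ => 0 := by
        filter_upwards [hT.isClosed.isOpen_compl.mem_nhds (fun h => hw (hTU h))] with x hx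
        exact hGz x hx
      exact contDiffAt_const.congr_of_eventuallyEq this
  have hGK : ∀ᶠ w in 𝓝ˢ K, G w = g w := by
    filter_upwards [hφ1] with w hw
    simp [hGdef, hw]
  have hDK : ∀ z ∈ K, ∀ᶠ w in 𝓝 z, dbar2 G w = 0 := by
    intro z hz
    have h1 : ∀ᶠ w in 𝓝 z, G w = g w := hGK.filter_mono (nhds_le_nhdsSet hz)
    filter_upwards [h1.eventually_nhds, hU.mem_nhds (hKU hz)] with w hw hwU
    have hgd : DifferentiableAt ℂ g w := hg.differentiableAt (hU.mem_nhds hwU)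
    exact dbar2_of_differentiableAt (hgd.congr_of_eventuallyEq hw)
  have hDc : Continuous (dbar2 G) := by
    have hcont : Continuous (fderiv ℝ G) := hG.continuous_fderiv one_ne_zero
    unfold dbar2
    fun_prop
  have hDT : ∀ w ∉ T, dbar2 G w = 0 := by
    intro w hw
    have : G =ᶠ[𝓝 w] fun _ => 0 := by
      filter_upwards [hT.isClosed.isOpen_compl.mem_nhds hw] with x hx
      exact hGz x hx
    exact dbar2_of_differentiableAt ((differentiableAt_const _).congr_of_eventuallyEq this)
  have hjoint : Continuous (fun x : ℂ × K => dbar2 G x.1 / (x.1 - x.2)) := by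
    rw [continuous_iff_continuousAt]
    rintro ⟨w, k⟩
    by_cases hwk : w = k
    · have h0 : (fun x : ℂ × K => dbar2 G x.1 / (x.1 - x.2)) =ᶠ[𝓝 (w, k)] fun _ => 0 := by
        have := (continuous_fst.tendsto (w, k)).eventually (hDK w (hwk ▸ k.2))
        filter_upwards [this] with x hx
        rw [hx, zero_div]
      exact continuousAt_const.congr h0.symm
    · apply ContinuousAt.div
      · exact (hDc.comp continuous_fst).continuousAt
      · fun_prop
      · exact sub_ne_zero.2 hwk
  let Φ : C(ℂ, C(K, ℂ)) := ContinuousMap.curry ⟨_, hjoint⟩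
  have hΦ (w : ℂ) (k : K) : Φ w k = dbar2 G w / (w - k) := rfl
  have hmem (w : ℂ) : Φ w ∈ (ratSub K).topologicalClosure := by
    apply Submodule.le_topologicalClosure
    by_cases hw : w ∈ K
    · have : Φ w = 0 := by
        ext k
        rw [hΦ, (hDK w hw).self_of_nhds, zero_div]
        rfl
      rw [this]
      exact zero_mem _
    · refine ⟨Polynomial.C (dbar2 G w), Polynomial.C w - Polynomial.X, fun z hz => ?_, fun z => ?_⟩
      · simp only [Polynomial.eval_sub, Polynomial.eval_C, Polynomial.eval_X]
        exact sub_ne_zero.2 (fun h => hw (h ▸ hz))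
      · rw [hΦ]; simp
  let S := (ratSub K).topologicalClosure
  have : CompleteSpace S := (Submodule.isClosed_topologicalClosure _).completeSpace_coe
  let Ψ : ℂ → S := fun w => ⟨Φ w, hmem w⟩
  have hΨc : Continuous Ψ := Φ.continuous.subtype_mk _
  have hΨ : Integrable Ψ := by
    apply hΨc.integrable_of_hasCompactSupport
    apply HasCompactSupport.intro hT
    intro w hw
    apply Subtype.ext
    ext k
    change dbar2 G w / (w - k) = 0
    rw [hDT w hw, zero_div]
  have hF2 : F = (-(2 * Real.pi) : ℂ)⁻¹ • ((∫ w, Ψ w : S) : C(K, ℂ)) := by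
    have h1 : ((∫ w, Ψ w : S) : C(K, ℂ)) = ∫ w, Φ w := (S.subtypeL.integral_comp_comm hΨ).symm
    have hΦi : Integrable Φ := S.subtypeL.integrable_comp hΨ
    rw [h1]
    ext k
    rw [ContinuousMap.smul_apply, ContinuousMap.integral_apply hΦi]
    simp only [hΦ]
    rw [cauchy_pompeiu hG hc, hF, (hGK.filter_mono (nhds_le_nhdsSet k.2)).self_of_nhds,
      smul_eq_mul, inv_mul_cancel_left₀]
    simp [Real.pi_ne_zero]
  rw [hF2]
  exact S.smul_mem _ (Subtype.coe_prop _)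

/-- Theorem `Runge`, the strong random Runge theorem of the paper.
Let `K ⊆ ℂ` be a nonempty compact set, `(Ω, 𝒜)` a measurable space and `f : Ω × K → ℂ`
with `f (·, z)` measurable for each `z ∈ K` and such that each `f (ω, ·)` is the
restriction to `K` of a function holomorphic on some open neighborhood of `K`. Then
there is a sequence of random rational functions pole-free on `K` converging to `f`
uniformly on `Ω × K`. -/
theorem strong_random_runge
    {Ω : Type*} [MeasurableSpace Ω] {K : Set ℂ} (hK : IsCompact K) (hKne : K.Nonempty)
    (f : Ω → ℂ → ℂ)
    (hf_meas : ∀ z ∈ K, Measurable fun ω => f ω z)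
    (hf_ext : ∀ ω : Ω, ∃ U : Set ℂ, IsOpen U ∧ K ⊆ U ∧
      ∃ g : ℂ → ℂ, DifferentiableOn ℂ g U ∧ ∀ z ∈ K, g z = f ω z) :
    ∃ r : ℕ → Ω → ℂ → ℂ,
      (∀ j : ℕ,
        (∀ z ∈ K, Measurable fun ω => r j ω z) ∧
        (∀ ω : Ω, ∃ p q : Polynomial ℂ, (∀ z ∈ K, q.eval z ≠ 0) ∧
          ∀ z ∈ K, r j ω z = p.eval z / q.eval z)) ∧
      (∀ ε > (0 : ℝ), ∃ N : ℕ, ∀ j ≥ N, ∀ ω : Ω, ∀ z ∈ K, ‖r j ω z - f ω z‖ < ε) := by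
  classical
  have : CompactSpace K := isCompact_iff_compactSpace.1 hK
  have : Nonempty K := hKne.to_subtype
  -- the functions `f ω` as continuous functions on `K`
  have hFex : ∀ ω, ∃ F : C(K, ℂ), (∀ z : K, F z = f ω z) ∧ F ∈ (ratSub K).topologicalClosure := by
    intro ω
    obtain ⟨U, hU, hKU, g, hg, hgf⟩ := hf_ext ω
    have hgc : ContinuousOn g K := hg.continuousOn.mono hKU
    refine ⟨⟨K.domRestrict g, hgc.domRestrict⟩, fun z => hgf z z.2, ?_⟩
    exact runge hK hU hKU hg _ (fun z => rfl)
  choose F hF hFm using hFex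
  let s : ℕ → ratSub K := TopologicalSpace.denseSeq (ratSub K)
  have hs : DenseRange s := TopologicalSpace.denseRange_denseSeq (ratSub K)
  have happ : ∀ (j : ℕ) (ω : Ω), ∃ n, ‖(s n : C(K, ℂ)) - F ω‖ ≤ 1 / ((j : ℝ) + 1) := by
    intro j ω
    have hpos : (0 : ℝ) < 1 / ((j : ℝ) + 1) := by positivity
    obtain ⟨h, hh, hd⟩ := Metric.mem_closure_iff.1 (hFm ω) _ (half_pos hpos)
    obtain ⟨n, hn⟩ := hs.exists_dist_lt (⟨h, hh⟩ : ratSub K) (half_pos hpos)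
    refine ⟨n, ?_⟩
    have hn2 : dist h (s n : C(K, ℂ)) < 1 / ((j : ℝ) + 1) / 2 := hn
    rw [← dist_eq_norm, dist_comm]
    linarith [dist_triangle (F ω) h (s n : C(K, ℂ))]
  let c : ℕ → K := TopologicalSpace.denseSeq K
  have hcd : DenseRange c := TopologicalSpace.denseRange_denseSeq K
  have hchar : ∀ (j n : ℕ) (ω : Ω), ‖(s n : C(K, ℂ)) - F ω‖ ≤ 1 / ((j : ℝ) + 1) ↔
      ∀ m, ‖(s n : C(K, ℂ)) (c m) - f ω (c m)‖ ≤ 1 / ((j : ℝ) + 1) := by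
    intro j n ω
    have hpos : (0 : ℝ) ≤ 1 / ((j : ℝ) + 1) := by positivity
    rw [ContinuousMap.norm_le _ hpos]
    constructor
    · intro h m
      have := h (c m)
      rwa [ContinuousMap.sub_apply, hF] at this
    · intro h x
      refine hcd.induction_on (p := fun x => ‖((s n : C(K, ℂ)) - F ω) x‖ ≤ 1 / ((j : ℝ) + 1)) x
        (isClosed_le (by fun_prop) continuous_const) (fun m => ?_)
      rw [ContinuousMap.sub_apply, hF]
      exact h m
  have hmeas : ∀ j n : ℕ, MeasurableSet {ω | ‖(s n : C(K, ℂ)) - F ω‖ ≤ 1 / ((j : ℝ) + 1)} := by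
    intro j n
    have : {ω | ‖(s n : C(K, ℂ)) - F ω‖ ≤ 1 / ((j : ℝ) + 1)} =
        ⋂ m, {ω | ‖(s n : C(K, ℂ)) (c m) - f ω (c m)‖ ≤ 1 / ((j : ℝ) + 1)} := by
      ext ω
      rw [Set.mem_iInter]
      exact hchar j n ω
    rw [this]
    refine MeasurableSet.iInter fun m => measurableSet_le ?_ measurable_const
    exact (measurable_const.sub (hf_meas _ (c m).2)).norm
  have hN : ∀ j, Measurable fun ω => Nat.find (happ j ω) := fun j =>
    measurable_find (happ j) (hmeas j)
  refine ⟨fun j ω z => if hz : z ∈ K then (s (Nat.find (happ j ω)) : C(K, ℂ)) ⟨z, hz⟩ else 0,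
    fun j => ⟨fun z hz => ?_, fun ω => ?_⟩, fun ε hε => ?_⟩
  · simp only [hz, dif_pos]
    exact (measurable_from_nat (f := fun n => (s n : C(K, ℂ)) ⟨z, hz⟩)).comp (hN j)
  · obtain ⟨p, q, hq, h⟩ := (s (Nat.find (happ j ω))).2
    refine ⟨p, q, hq, fun z hz => ?_⟩
    simp only [hz, dif_pos]
    exact h ⟨z, hz⟩
  · obtain ⟨N, hN⟩ := exists_nat_one_div_lt hε
    refine ⟨N, fun j hj ω z hz => ?_⟩
    simp only [hz, dif_pos]
    have h1 := ContinuousMap.norm_coe_le_norm ((s (Nat.find (happ j ω)) : C(K, ℂ)) - F ω) ⟨z, hz⟩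
    rw [ContinuousMap.sub_apply, hF] at h1
    have h2 := Nat.find_spec (happ j ω)
    have h3 : 1 / ((j : ℝ) + 1) ≤ 1 / ((N : ℝ) + 1) := by
      have : (N : ℝ) ≤ j := by exact_mod_cast hj
      gcongr
    exact lt_of_le_of_lt (h1.trans (h2.trans h3)) hN
end

section
/- Let (Ω, 𝒜, μ) be a σ-finite measure space and let K : Ω → 𝒦′(ℂⁿ) be a random compact set whose range {K(ω) : ω ∈ Ω} is countable. Suppose K is polynomially convex, i.e., K(ω) = K̂(ω) for all ω. Let f be a generalized random function on K such that for each ω, f(ω,·) extends to a function holomorphic on some open neighborhood of K(ω), and let ε : Ω → ℝ be a measurable function with ε(ω) > 0 for all ω. Then there exists a generalized random polynomial p : Ω × ℂⁿ → ℂ (p(ω,·) is a multivariate polynomial for each ω, and p(·,z) is measurable on K⁻¹(z) for each z with K⁻¹(z) ≠ ∅) and a measurable set L ⊆ Ω with μ(L) = 0 such that for all ω ∉ L, sup_{x ∈ K(ω)} |p(ω,x) − f(ω,x)| < ε(ω). -/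
open TopologicalSpace MvPolynomial MeasureTheory

namespace OkaWeil
open Set Filter Topology Metric

/-- `f` is holomorphic in a neighbourhood of `X`. -/
def Hol {E : Type} [NormedAddCommGroup E] [NormedSpace ℂ E] (f : E → ℂ) (X : Set E) : Prop :=
  ∀ᶠ y in 𝓝ˢ X, DifferentiableAt ℂ f y

section basic
variable {E : Type} [NormedAddCommGroup E] [NormedSpace ℂ E]
  {F : Type} [NormedAddCommGroup F] [NormedSpace ℂ F]

lemma Hol.mono {f : E → ℂ} {X Y : Set E} (h : Hol f Y) (hXY : X ⊆ Y) : Hol f X :=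
  h.filter_mono (nhdsSet_mono hXY)

lemma Hol.ev {f : E → ℂ} {X : Set E} (h : Hol f X) {x : E} (hx : x ∈ X) :
    ∀ᶠ y in 𝓝 x, DifferentiableAt ℂ f y := h.filter_mono (nhds_le_nhdsSet hx)

lemma hol_iff {f : E → ℂ} {X : Set E} :
    Hol f X ↔ ∀ x ∈ X, ∀ᶠ y in 𝓝 x, DifferentiableAt ℂ f y := eventually_nhdsSet_iff_forall

lemma Hol.add {f g : E → ℂ} {X : Set E} (hf : Hol f X) (hg : Hol g X) :
    Hol (fun x => f x + g x) X := by
  filter_upwards [hf, hg] with x h1 h2 using h1.fun_add h2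

lemma Hol.sub {f g : E → ℂ} {X : Set E} (hf : Hol f X) (hg : Hol g X) :
    Hol (fun x => f x - g x) X := by
  filter_upwards [hf, hg] with x h1 h2 using h1.fun_sub h2

lemma Hol.mul {f g : E → ℂ} {X : Set E} (hf : Hol f X) (hg : Hol g X) :
    Hol (fun x => f x * g x) X := by
  filter_upwards [hf, hg] with x h1 h2 using h1.fun_mul h2

lemma Hol.neg {f : E → ℂ} {X : Set E} (hf : Hol f X) :
    Hol (fun x => - f x) X := by
  filter_upwards [hf] with x h1 using h1.fun_neg

lemma Differentiable.hol {f : E → ℂ} (hf : Differentiable ℂ f) (X : Set E) : Hol f X :=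
  Eventually.of_forall hf

lemma Hol.comp {f : F → ℂ} {Y : Set F} (hf : Hol f Y) {φ : E → F} (hφ : Differentiable ℂ φ)
    {X : Set E} (hXY : MapsTo φ X Y) : Hol (fun x => f (φ x)) X := by
  have := (hφ.continuous.tendsto_nhdsSet hXY).eventually hf
  filter_upwards [this] with x hx
  exact hx.comp x (hφ x)

lemma Hol.congr {f g : E → ℂ} {X : Set E} (hf : Hol f X) (h : ∀ᶠ x in 𝓝ˢ X, g x = f x) :
    Hol g X := by
  filter_upwards [hf, h.eventually_nhdsSet] with x h1 h2
  exact h1.congr_of_eventuallyEq h2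

end basic

section paramInt
variable {E : Type} [NormedAddCommGroup E] [NormedSpace ℂ E] [FiniteDimensional ℂ E]

lemma paramInt (Φ : E × ℂ → ℂ) (γ c : ℝ → ℂ) (hγ : Continuous γ) (hc : Continuous c) (a b : ℝ)
    (x0 : E) (h : ∀ t ∈ uIcc a b, ∀ᶠ y in 𝓝 (x0, γ t), DifferentiableAt ℂ Φ y) :
    DifferentiableAt ℂ (fun x => ∫ t in a..b, c t * Φ (x, γ t)) x0 := by
  have : ProperSpace E := FiniteDimensional.proper ℂ E
  have hcomp : IsCompact (γ '' uIcc a b) := isCompact_uIcc.image hγ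
  have hU : ∀ᶠ y in 𝓝ˢ (({x0} : Set E) ×ˢ (γ '' uIcc a b)), DifferentiableAt ℂ Φ y := by
    rw [eventually_nhdsSet_iff_forall]
    rintro ⟨x, z⟩ ⟨hx, t, ht, rfl⟩
    obtain rfl : x = x0 := hx
    exact h t ht
  obtain ⟨U, hUo, hTU, hUd⟩ := eventually_nhdsSet_iff_exists.1 hU
  obtain ⟨u, v, huo, hvo, hxu, hγv, huv⟩ := generalized_tube_lemma isCompact_singleton hcomp hUo hTU
  obtain ⟨r, hr, hru⟩ := Metric.isOpen_iff.1 huo x0 (hxu rfl)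
  have hd : ∀ x ∈ ball x0 r, ∀ t ∈ uIcc a b, DifferentiableAt ℂ Φ (x, γ t) := fun x hx t ht =>
    hUd _ (huv ⟨hru hx, hγv ⟨t, ht, rfl⟩⟩)
  have hd' : ∀ x ∈ ball x0 r, ∀ t ∈ uIcc a b, DifferentiableAt ℂ (fun y => Φ (y, γ t)) x := by
    intro x hx t ht
    exact (hd x hx t ht).comp x (f := fun y => (y, γ t)) (by fun_prop)
  have hcont : ContinuousOn Φ (closedBall x0 (r/2) ×ˢ (γ '' uIcc a b)) := by
    rintro ⟨x, z⟩ ⟨hx, t, ht, rfl⟩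
    exact (hd x (closedBall_subset_ball (by linarith) hx) t ht).continuousAt.continuousWithinAt
  obtain ⟨M, hM⟩ := ((isCompact_closedBall x0 (r/2)).prod hcomp).exists_bound_of_continuousOn hcont
  have hcontx : ∀ x ∈ ball x0 r, ContinuousOn (fun t => c t * Φ (x, γ t)) (uIcc a b) := by
    intro x hx t ht
    have : ContinuousAt (fun t => Φ (x, γ t)) t :=
      ContinuousAt.comp (f := fun t => (x, γ t)) (hd x hx t ht).continuousAt (by fun_prop)
    exact (hc.continuousAt.mul this).continuousWithinAt
  refine (intervalIntegral.hasFDerivAt_integral_of_dominated_of_fderiv_le (𝕜 := ℂ)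
    (s := ball x0 (r/4)) (bound := fun t => ‖c t‖ * (2 * M / (r/4)))
    (F' := fun x t => c t • fderiv ℂ (fun y => Φ (y, γ t)) x)
    (ball_mem_nhds x0 (by linarith)) ?_ ?_ ?_ ?_ ?_ ?_).differentiableAt
  · filter_upwards [ball_mem_nhds x0 hr] with x hx
    exact ((hcontx x hx).mono uIoc_subset_uIcc).aestronglyMeasurable measurableSet_uIoc
  · exact (hcontx x0 (mem_ball_self hr)).intervalIntegrable
  · borelize (E × ℂ)
    have : ProperSpace (E × ℂ →L[ℂ] ℂ) := FiniteDimensional.proper ℂ _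
    have h1 : Measurable (fun t => fderiv ℂ Φ (x0, γ t)) :=
      (measurable_fderiv ℂ Φ).comp (by
        have : Continuous (fun t => (x0, γ t)) := by fun_prop
        exact this.measurable)
    have h2 : StronglyMeasurable
        (fun t => c t • (fderiv ℂ Φ (x0, γ t)).comp (ContinuousLinearMap.inl ℂ E ℂ)) := by
      refine hc.stronglyMeasurable.smul ?_
      have hcc : Continuous (fun L : E × ℂ →L[ℂ] ℂ => L.comp (ContinuousLinearMap.inl ℂ E ℂ)) := by
        fun_prop
      exact hcc.comp_stronglyMeasurable h1.stronglyMeasurable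
    refine h2.aestronglyMeasurable.congr ?_
    rw [EventuallyEq, ae_restrict_iff' measurableSet_uIoc]
    refine Eventually.of_forall fun t ht => ?_
    have := (hd x0 (mem_ball_self hr) t (uIoc_subset_uIcc ht)).hasFDerivAt.comp x0
      (f := fun y => (y, γ t)) (hasFDerivAt_prodMk_left x0 (γ t))
    simp only [Function.comp_def] at this
    rw [this.fderiv]
  · refine Eventually.of_forall fun t ht x hx => ?_
    rw [norm_smul]
    gcongr
    have hx' : dist x x0 < r/4 := hx
    have hsub : ball x (r/4) ⊆ closedBall x0 (r/2) := by
      intro y hy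
      have : dist y x < r/4 := hy
      have := dist_triangle y x x0
      rw [mem_closedBall]; linarith
    refine Complex.norm_fderiv_le_div_of_mapsTo_ball (R₂ := 2 * M) ?_ ?_ (by linarith)
    · intro y hy
      exact (hd' y (closedBall_subset_ball (by linarith) (hsub hy)) t
        (uIoc_subset_uIcc ht)).differentiableWithinAt
    · intro y hy
      have h1 := hM (y, γ t) ⟨hsub hy, t, uIoc_subset_uIcc ht, rfl⟩
      have h2 := hM (x, γ t) ⟨hsub (mem_ball_self (by linarith)), t, uIoc_subset_uIcc ht, rfl⟩
      rw [mem_closedBall, dist_eq_norm]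
      exact (norm_sub_le _ _).trans (by linarith)
  · exact (Continuous.intervalIntegrable (by fun_prop) _ _)
  · refine Eventually.of_forall fun t ht x hx => ?_
    exact ((hd' x (ball_subset_ball (by linarith) hx) t (uIoc_subset_uIcc ht)).hasFDerivAt).const_mul (c t)

/-- Eventual version. -/
lemma paramInt_ev (Φ : E × ℂ → ℂ) (γ c : ℝ → ℂ) (hγ : Continuous γ) (hc : Continuous c) (a b : ℝ)
    (x0 : E) (h : ∀ t ∈ uIcc a b, ∀ᶠ y in 𝓝 (x0, γ t), DifferentiableAt ℂ Φ y) :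
    ∀ᶠ x in 𝓝 x0, DifferentiableAt ℂ (fun x => ∫ t in a..b, c t * Φ (x, γ t)) x := by
  have hcomp : IsCompact (γ '' uIcc a b) := isCompact_uIcc.image hγ
  have : ∀ᶠ x in 𝓝 x0, ∀ t ∈ uIcc a b, ∀ᶠ y in 𝓝 (x, γ t), DifferentiableAt ℂ Φ y := by
    apply isCompact_uIcc.eventually_forall_of_forall_eventually
    intro t ht
    have h1 := (h t ht).eventually_nhds
    have : Tendsto (fun p : E × ℝ => (p.1, γ p.2)) (𝓝 (x0, t)) (𝓝 (x0, γ t)) :=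
      Continuous.tendsto (by fun_prop) (x0, t)
    exact this.eventually h1
  filter_upwards [this] with x hx
  exact paramInt Φ γ c hγ hc a b x hx

end paramInt
end OkaWeil

namespace OkaWeil
open Set Filter Topology Metric Complex

lemma int_inv_horiz (p q v : ℝ) (u : ℂ) (huv : v - u.im ≠ 0) :
    ∫ x : ℝ in p..q, ((x : ℂ) + v * I - u)⁻¹
      = log ((q : ℂ) + v * I - u) - log ((p : ℂ) + v * I - u) := by
  have hne : ∀ x : ℝ, ((x : ℂ) + v * I - u).im ≠ 0 := by
    intro x; simpa using huv
  apply intervalIntegral.integral_eq_sub_of_hasDerivAt (f := fun x : ℝ => log ((x : ℂ) + v * I - u))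
  · intro x _
    have h1 : HasDerivAt (fun x : ℝ => (x : ℂ) + v * I - u) 1 x :=
      ((hasDerivAt_id x).ofReal_comp.add_const _).sub_const _
    have h2 := h1.clog_real (Or.inr (hne x))
    simpa using h2
  · apply ContinuousOn.intervalIntegrable
    intro x _
    refine (ContinuousAt.inv₀ (by fun_prop) ?_).continuousWithinAt
    intro h0; exact hne x (by rw [h0]; simp)

lemma int_inv_vert (p q v : ℝ) (u : ℂ) (huv : u.re < v) :
    I * ∫ y : ℝ in p..q, ((v : ℂ) + y * I - u)⁻¹
      = log ((v : ℂ) + q * I - u) - log ((v : ℂ) + p * I - u) := by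
  have hne : ∀ x : ℝ, 0 < ((v : ℂ) + x * I - u).re := by
    intro x; simpa using huv
  rw [← intervalIntegral.integral_const_mul]
  apply intervalIntegral.integral_eq_sub_of_hasDerivAt (f := fun x : ℝ => log ((v : ℂ) + x * I - u))
  · intro x _
    have h1 : HasDerivAt (fun x : ℝ => (v : ℂ) + x * I - u) I x := by
      have := ((((hasDerivAt_id x).ofReal_comp).mul_const I).const_add (v : ℂ)).sub_const u
      simpa using this
    have h2 := h1.clog_real (Or.inl (hne x))
    simpa [div_eq_mul_inv] using h2
  · apply ContinuousOn.intervalIntegrable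
    intro x _
    refine (ContinuousAt.mul (by fun_prop) (ContinuousAt.inv₀ (by fun_prop) ?_)).continuousWithinAt
    intro h0; have := hne x; rw [h0] at this; simp at this

lemma int_inv_vert' (p q v : ℝ) (u : ℂ) (huv : v < u.re) :
    I * ∫ y : ℝ in p..q, ((v : ℂ) + y * I - u)⁻¹
      = log (-((v : ℂ) + q * I - u)) - log (-((v : ℂ) + p * I - u)) := by
  have hne : ∀ x : ℝ, 0 < (-((v : ℂ) + x * I - u)).re := by
    intro x; simpa using huv
  rw [← intervalIntegral.integral_const_mul]
  apply intervalIntegral.integral_eq_sub_of_hasDerivAt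
    (f := fun x : ℝ => log (-((v : ℂ) + x * I - u)))
  · intro x _
    have h1 : HasDerivAt (fun x : ℝ => -((v : ℂ) + x * I - u)) (-I) x := by
      have := (((((hasDerivAt_id x).ofReal_comp).mul_const I).const_add (v : ℂ)).sub_const u).fun_neg
      simpa using this
    have h2 := h1.clog_real (Or.inl (hne x))
    rw [neg_div_neg_eq] at h2
    simpa [div_eq_mul_inv] using h2
  · apply ContinuousOn.intervalIntegrable
    intro x _
    refine (ContinuousAt.mul (by fun_prop) (ContinuousAt.inv₀ (by fun_prop) ?_)).continuousWithinAt
    intro h0; have := hne x; rw [h0] at this; simp at this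

lemma log_sub_log_neg {u : ℂ} (hu : 0 < u.im) : log u - log (-u) = Real.pi * I := by
  simp only [log, norm_neg, arg_neg_eq_arg_sub_pi_of_im_pos hu]
  push_cast; ring

lemma rectJ (a b c d : ℝ) (u : ℂ) (ha : a < u.re) (hb : u.re < b) (hc : c < u.im) (hd : u.im < d) :
    (∫ x : ℝ in a..b, ((x : ℂ) + c * I - u)⁻¹) - (∫ x : ℝ in a..b, ((x : ℂ) + d * I - u)⁻¹)
    + I * (∫ y : ℝ in c..d, ((b : ℂ) + y * I - u)⁻¹) - I * (∫ y : ℝ in c..d, ((a : ℂ) + y * I - u)⁻¹)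
    = 2 * Real.pi * I := by
  rw [int_inv_horiz a b c u (by linarith), int_inv_horiz a b d u (by linarith),
    int_inv_vert c d b u hb, int_inv_vert' c d a u ha]
  have h1 := log_sub_log_neg (u := ((a : ℂ) + d * I - u)) (by simpa using hd)
  have h2 := log_sub_log_neg (u := -((a : ℂ) + c * I - u)) (by simpa using hc)
  rw [neg_neg] at h2
  linear_combination h1 + h2

lemma rectCauchy (g : ℂ → ℂ) (a b c d : ℝ) (u : ℂ) (ha : a < u.re) (hb : u.re < b) (hc : c < u.im)
    (hd : u.im < d) (hg : ∀ z ∈ Icc a b ×ℂ Icc c d, DifferentiableAt ℂ g z) :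
    (∫ x : ℝ in a..b, g (x + c * I) / ((x : ℂ) + c * I - u))
    - (∫ x : ℝ in a..b, g (x + d * I) / ((x : ℂ) + d * I - u))
    + I * (∫ y : ℝ in c..d, g (b + y * I) / ((b : ℂ) + y * I - u))
    - I * (∫ y : ℝ in c..d, g (a + y * I) / ((a : ℂ) + y * I - u))
    = 2 * Real.pi * I * g u := by
  have hab : a ≤ b := by linarith
  have hcd : c ≤ d := by linarith
  have hnhds : Icc a b ×ℂ Icc c d ∈ 𝓝 u := by
    have : Ioo a b ×ℂ Ioo c d ∈ 𝓝 u :=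
      (isOpen_Ioo.reProdIm isOpen_Ioo).mem_nhds ⟨⟨ha, hb⟩, ⟨hc, hd⟩⟩
    exact mem_of_superset this (reProdIm_subset_iff.2 (prod_mono Ioo_subset_Icc_self Ioo_subset_Icc_self))
  have key := integral_boundary_rect_eq_zero_of_differentiable_on_off_countable (dslope g u)
    (⟨a, c⟩ : ℂ) (⟨b, d⟩ : ℂ) {u} (countable_singleton u)
    (by
      simp only [uIcc_of_le hab, uIcc_of_le hcd]
      exact (continuousOn_dslope hnhds).2
        ⟨fun z hz => (hg z hz).continuousAt.continuousWithinAt, hg u (mem_of_mem_nhds hnhds)⟩)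
    (by
      rintro z ⟨hz, hzu⟩
      simp only [min_eq_left hab, min_eq_left hcd, max_eq_right hab, max_eq_right hcd] at hz
      rw [differentiableAt_dslope_of_ne hzu]
      exact hg z ⟨Ioo_subset_Icc_self hz.1, Ioo_subset_Icc_self hz.2⟩)
  simp only [smul_eq_mul] at key
  have hJ := rectJ a b c d u ha hb hc hd
  -- sides
  have side : ∀ (γ : ℝ → ℂ) (p q : ℝ), p ≤ q → Continuous γ → (∀ t ∈ Icc p q, γ t ≠ u) →
      (∀ t ∈ Icc p q, γ t ∈ Icc a b ×ℂ Icc c d) →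
      ∫ t in p..q, dslope g u (γ t) =
        (∫ t in p..q, g (γ t) / (γ t - u)) - g u * ∫ t in p..q, (γ t - u)⁻¹ := by
    intro γ p q hpq hγ hne hmem
    have i2 : IntervalIntegrable (fun t => g u * (γ t - u)⁻¹) volume p q := by
      apply ContinuousOn.intervalIntegrable
      intro t ht
      rw [uIcc_of_le hpq] at ht
      have hc1 : ContinuousAt (fun t => γ t - u) t := by fun_prop
      have hc2 := hc1.inv₀ (sub_ne_zero.2 (hne t ht))
      exact (continuousAt_const.fun_mul hc2).continuousWithinAt
    have i1 : IntervalIntegrable (fun t => g (γ t) / (γ t - u)) volume p q := by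
      apply ContinuousOn.intervalIntegrable
      intro t ht
      rw [uIcc_of_le hpq] at ht
      exact (ContinuousAt.div (ContinuousAt.comp (hg _ (hmem t ht)).continuousAt hγ.continuousAt)
        (by fun_prop) (sub_ne_zero.2 (hne t ht))).continuousWithinAt
    rw [← intervalIntegral.integral_const_mul, ← intervalIntegral.integral_sub i1 i2]
    apply intervalIntegral.integral_congr
    intro t ht
    rw [uIcc_of_le hpq] at ht
    simp only [dslope_of_ne g (hne t ht), slope_def_field]
    rw [sub_div, div_eq_mul_inv (g u)]
  have s1 := side (fun x => (x : ℂ) + c * I) a b hab (by fun_prop)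
    (fun t _ h => by have := congrArg im h; simp at this; linarith)
    (fun t ht => ⟨by simpa using ht, by simpa using hcd⟩)
  have s2 := side (fun x => (x : ℂ) + d * I) a b hab (by fun_prop)
    (fun t _ h => by have := congrArg im h; simp at this; linarith)
    (fun t ht => ⟨by simpa using ht, by simpa using hcd⟩)
  have s3 := side (fun y => (b : ℂ) + y * I) c d hcd (by fun_prop)
    (fun t _ h => by have := congrArg re h; simp at this; linarith)
    (fun t ht => ⟨by simpa using hab, by simpa using ht⟩)
  have s4 := side (fun y => (a : ℂ) + y * I) c d hcd (by fun_prop)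
    (fun t _ h => by have := congrArg re h; simp at this; linarith)
    (fun t ht => ⟨by simpa using hab, by simpa using ht⟩)
  rw [s1, s2, s3, s4] at key
  linear_combination key + g u * hJ

end OkaWeil

namespace OkaWeil
open Set Filter Topology Metric Complex

/-- Replace the `ℓ`-coordinate of `p.1` by `p.2`. -/
noncomputable def repl {E : Type} [NormedAddCommGroup E] [NormedSpace ℂ E] (ℓ : E →L[ℂ] ℂ) (e : E) (p : E × ℂ) : E :=
  p.1 + (p.2 - ℓ p.1) • e

section
variable {E : Type} [NormedAddCommGroup E] [NormedSpace ℂ E]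

lemma repl_diff (ℓ : E →L[ℂ] ℂ) (e : E) : Differentiable ℂ (repl ℓ e) := by
  unfold repl; fun_prop

lemma exists_fat_rect (V : Set ℂ) (hV : IsOpen V) (a b c d : ℝ) (hab : a ≤ b) (hcd : c ≤ d)
    (h : Icc a b ×ℂ Icc c d ⊆ V) :
    ∃ η > 0, Icc (a - η) (b + η) ×ℂ Icc (c - η) (d + η) ⊆ V := by
  have hcomp : IsCompact (Icc a b ×ℂ Icc c d) := isCompact_Icc.reProdIm isCompact_Icc
  obtain ⟨δ, hδ, hδV⟩ := hcomp.exists_thickening_subset_open hV h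
  refine ⟨δ / 3, by linarith, fun z hz => hδV ?_⟩
  rw [mem_thickening_iff]
  have cl : ∀ p q x : ℝ, p ≤ q → x ∈ Icc (p - δ/3) (q + δ/3) → ∃ y ∈ Icc p q, |x - y| ≤ δ/3 := by
    intro p q x hpq hx
    rcases le_total x p with h | h
    · exact ⟨p, ⟨le_rfl, hpq⟩, by rw [abs_le]; constructor <;> linarith [hx.1]⟩
    rcases le_total x q with h' | h'
    · exact ⟨x, ⟨h, h'⟩, by simp; linarith⟩
    · exact ⟨q, ⟨hpq, le_rfl⟩, by rw [abs_le]; constructor <;> linarith [hx.2]⟩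
  obtain ⟨x, hx, hx'⟩ := cl a b z.re hab hz.1
  obtain ⟨y, hy, hy'⟩ := cl c d z.im hcd hz.2
  refine ⟨⟨x, y⟩, ⟨hx, hy⟩, ?_⟩
  rw [dist_eq_norm]
  refine (norm_le_abs_re_add_abs_im _).trans_lt ?_
  simp only [sub_re, sub_im]
  linarith

variable [FiniteDimensional ℂ E]

lemma cousin4 (ℓ : E →L[ℂ] ℂ) (e : E) (T : Set E) (hT : IsCompact T)
    (a b c d : ℝ) (hab : a ≤ b) (hcd : c ≤ d) (h : E → ℂ)
    (hh : ∀ x ∈ T, ∀ ζ ∈ Icc a b ×ℂ Icc c d, ∀ᶠ y in 𝓝 (repl ℓ e (x, ζ)), DifferentiableAt ℂ h y) :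
    ∃ η > 0, ∃ IB IR IT IL : E → ℂ,
      (∀ x ∈ T, c - η < (ℓ x).im → ∀ᶠ y in 𝓝 x, DifferentiableAt ℂ IB y) ∧
      (∀ x ∈ T, (ℓ x).re < b + η → ∀ᶠ y in 𝓝 x, DifferentiableAt ℂ IR y) ∧
      (∀ x ∈ T, (ℓ x).im < d + η → ∀ᶠ y in 𝓝 x, DifferentiableAt ℂ IT y) ∧
      (∀ x ∈ T, a - η < (ℓ x).re → ∀ᶠ y in 𝓝 x, DifferentiableAt ℂ IL y) ∧
      ∀ x ∈ T, ℓ x ∈ Icc a b ×ℂ Icc c d →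
        ∀ᶠ y in 𝓝 x, h y = IB y + IR y + IT y + IL y := by
  have hop : IsOpen {p : E × ℂ | ∀ᶠ y in 𝓝 (repl ℓ e p), DifferentiableAt ℂ h y} := by
    have : IsOpen {y : E | ∀ᶠ y' in 𝓝 y, DifferentiableAt ℂ h y'} := isOpen_setOfPred_eventually_nhds
    exact this.preimage (repl_diff ℓ e).continuous
  obtain ⟨u, v, huo, hvo, hTu, hSv, huv⟩ := generalized_tube_lemma hT
    (isCompact_Icc.reProdIm isCompact_Icc : IsCompact (Icc a b ×ℂ Icc c d)) hop
    (fun p hp => hh p.1 hp.1 p.2 hp.2)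
  obtain ⟨η, hη, hηv⟩ := exists_fat_rect v hvo a b c d hab hcd hSv
  have hfat : ∀ x ∈ T, ∀ ζ ∈ Icc (a - η) (b + η) ×ℂ Icc (c - η) (d + η),
      ∀ᶠ y in 𝓝 (repl ℓ e (x, ζ)), DifferentiableAt ℂ h y := fun x hx ζ hζ =>
    huv (show (x, ζ) ∈ u ×ˢ v from ⟨hTu hx, hηv hζ⟩)
  let Φ : E × ℂ → ℂ := fun p => h (repl ℓ e p) / (p.2 - ℓ p.1)
  have hΦ : ∀ x ∈ T, ∀ ζ ∈ Icc (a - η) (b + η) ×ℂ Icc (c - η) (d + η), ζ ≠ ℓ x →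
      ∀ᶠ p in 𝓝 (x, ζ), DifferentiableAt ℂ Φ p := by
    intro x hx ζ hζ hne
    have h1 : ∀ᶠ p in 𝓝 (x, ζ), DifferentiableAt ℂ h (repl ℓ e p) :=
      ((repl_diff ℓ e).continuous.tendsto (x, ζ)).eventually (hfat x hx ζ hζ)
    have h2 : ∀ᶠ p : E × ℂ in 𝓝 (x, ζ), p.2 - ℓ p.1 ≠ 0 := by
      have : Continuous (fun p : E × ℂ => p.2 - ℓ p.1) := by fun_prop
      exact this.continuousAt.eventually_ne (sub_ne_zero.2 hne)
    filter_upwards [h1, h2] with p hp1 hp2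
    have h3 : DifferentiableAt ℂ (fun p => h (repl ℓ e p)) p := hp1.comp p (repl_diff ℓ e p)
    have h4 : DifferentiableAt ℂ (fun p : E × ℂ => p.2 - ℓ p.1) p := by fun_prop
    have h5 := h3.fun_mul (h4.fun_inv hp2)
    simpa only [Φ, div_eq_mul_inv] using h5
  have hpi : (2 * Real.pi * I : ℂ) ≠ 0 := Complex.two_pi_I_ne_zero
  set k : ℂ := (2 * Real.pi * I)⁻¹ with hk
  have mab : a - η ≤ b + η := by linarith
  have mcd : c - η ≤ d + η := by linarith
  refine ⟨η, hη,
    fun x => ∫ t in (a - η)..(b + η), k * Φ (x, (t : ℂ) + (c - η : ℝ) * I),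
    fun x => ∫ t in (c - η)..(d + η), (k * I) * Φ (x, (b + η : ℝ) + (t : ℂ) * I),
    fun x => ∫ t in (a - η)..(b + η), (-k) * Φ (x, (t : ℂ) + (d + η : ℝ) * I),
    fun x => ∫ t in (c - η)..(d + η), (-k * I) * Φ (x, (a - η : ℝ) + (t : ℂ) * I),
    ?_, ?_, ?_, ?_, ?_⟩
  · intro x hx hlt
    refine paramInt_ev Φ (fun t => (t : ℂ) + (c - η : ℝ) * I) (fun _ => k) (by fun_prop)
      (by fun_prop) _ _ x fun t ht => hΦ x hx _ ?_ ?_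
    · rw [uIcc_of_le mab] at ht
      exact ⟨by simpa using ht, by simpa using mcd⟩
    · intro h; have := congrArg im h; simp at this; linarith
  · intro x hx hlt
    refine paramInt_ev Φ (fun t => (b + η : ℝ) + (t : ℂ) * I) (fun _ => k * I) (by fun_prop)
      (by fun_prop) _ _ x fun t ht => hΦ x hx _ ?_ ?_
    · rw [uIcc_of_le mcd] at ht
      exact ⟨by simpa using mab, by simpa using ht⟩
    · intro h; have := congrArg re h; simp at this; linarith
  · intro x hx hlt
    refine paramInt_ev Φ (fun t => (t : ℂ) + (d + η : ℝ) * I) (fun _ => -k) (by fun_prop)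
      (by fun_prop) _ _ x fun t ht => hΦ x hx _ ?_ ?_
    · rw [uIcc_of_le mab] at ht
      exact ⟨by simpa using ht, by simpa using mcd⟩
    · intro h; have := congrArg im h; simp at this; linarith
  · intro x hx hlt
    refine paramInt_ev Φ (fun t => (a - η : ℝ) + (t : ℂ) * I) (fun _ => -k * I) (by fun_prop)
      (by fun_prop) _ _ x fun t ht => hΦ x hx _ ?_ ?_
    · rw [uIcc_of_le mcd] at ht
      exact ⟨by simpa using mab, by simpa using ht⟩
    · intro h; have := congrArg re h; simp at this; linarith
  · intro x hx hxS
    have e1 : ∀ᶠ y in 𝓝 x, ∀ ζ ∈ Icc (a - η) (b + η) ×ℂ Icc (c - η) (d + η),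
        DifferentiableAt ℂ h (repl ℓ e (y, ζ)) := by
      apply IsCompact.eventually_forall_of_forall_eventually
        (isCompact_Icc.reProdIm isCompact_Icc)
      intro ζ hζ
      exact ((repl_diff ℓ e).continuous.tendsto (x, ζ)).eventually (hfat x hx ζ hζ)
    have e2 : ∀ᶠ y in 𝓝 x, ℓ y ∈ Ioo (a - η) (b + η) ×ℂ Ioo (c - η) (d + η) := by
      refine ℓ.continuous.continuousAt.eventually_mem
        ((isOpen_Ioo.reProdIm isOpen_Ioo).mem_nhds ⟨⟨?_, ?_⟩, ⟨?_, ?_⟩⟩)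
      · linarith [hxS.1.1]
      · linarith [hxS.1.2]
      · linarith [hxS.2.1]
      · linarith [hxS.2.2]
    filter_upwards [e1, e2] with y hy1 hy2
    have := rectCauchy (fun ζ => h (repl ℓ e (y, ζ))) (a - η) (b + η) (c - η) (d + η) (ℓ y)
      hy2.1.1 hy2.1.2 hy2.2.1 hy2.2.2 (fun ζ hζ =>
        (hy1 ζ hζ).comp ζ ((repl_diff ℓ e).differentiableAt.comp ζ
          (f := fun ζ => (y, ζ)) (by fun_prop)))
    have hy : repl ℓ e (y, ℓ y) = y := by simp [repl]
    simp only [hy] at this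
    simp only [intervalIntegral.integral_const_mul, Φ]
    have h3 : h y = k * (2 * Real.pi * I * h y) := by
      rw [hk]; field_simp
    rw [h3, ← this]
    ring

end
end OkaWeil

namespace OkaWeil
open Set Filter Topology Metric Complex

lemma glue {E : Type} [TopologicalSpace E] [T2Space E] {X₁ X₂ : Set E} (h₁ : IsCompact X₁)
    (h₂ : IsCompact X₂) (F₁ F₂ : E → ℂ) (h : ∀ᶠ x in 𝓝ˢ (X₁ ∩ X₂), F₁ x = F₂ x) :
    ∃ F : E → ℂ, (∀ᶠ x in 𝓝ˢ X₁, F x = F₁ x) ∧ (∀ᶠ x in 𝓝ˢ X₂, F x = F₂ x) := by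
  classical
  rw [h₁.nhdsSet_inter_eq h₂, Filter.eventually_inf] at h
  obtain ⟨U₁, hU₁, U₂, hU₂, hU⟩ := h
  refine ⟨fun x => if x ∈ U₁ then F₁ x else F₂ x, ?_, ?_⟩
  · filter_upwards [hU₁] with x hx
    simp [hx]
  · filter_upwards [hU₂] with x hx
    by_cases hx1 : x ∈ U₁
    · simp [hx1, hU x ⟨hx1, hx⟩]
    · simp [hx1]

section
variable {Z W : Type} [NormedAddCommGroup Z] [NormedSpace ℂ Z] [FiniteDimensional ℂ Z]
  [NormedAddCommGroup W] [NormedSpace ℂ W] [FiniteDimensional ℂ W]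

lemma division (G : Z × (ℂ × W) → ℂ) (p : Z → ℂ) (hp : Differentiable ℂ p) (A : Set Z) (D : Set ℂ)
    (DW : Set W) (hG : Hol G (A ×ˢ (D ×ˢ DW)))
    (h0 : ∀ᶠ x in 𝓝ˢ ((A ∩ p ⁻¹' D) ×ˢ DW), G (x.1, (p x.1, x.2)) = 0) :
    ∃ C : Z × (ℂ × W) → ℂ, Hol C (A ×ˢ (D ×ˢ DW)) ∧
      ∀ᶠ x in 𝓝ˢ (A ×ˢ (D ×ˢ DW)), G x = (x.2.1 - p x.1) * C x := by
  classical
  let C : Z × (ℂ × W) → ℂ := fun x =>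
    if x.2.1 = p x.1 then deriv (fun t => G (x.1, (t + p x.1, x.2.2))) 0
    else G x / (x.2.1 - p x.1)
  have hpc := hp.continuous
  -- vanishing near good points
  have hvan : ∀ x ∈ A ×ˢ (D ×ˢ DW), x.2.1 = p x.1 →
      ∀ᶠ y in 𝓝 x, G (y.1, (p y.1, y.2.2)) = 0 := by
    rintro ⟨z, u, w⟩ ⟨hz, hu, hw⟩ hup
    have hm : (z, w) ∈ (A ∩ p ⁻¹' D) ×ˢ DW :=
      ⟨⟨hz, by rw [mem_preimage, ← show u = p z from hup]; exact hu⟩, hw⟩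
    have h1 : ∀ᶠ x in 𝓝 (z, w), G (x.1, (p x.1, x.2)) = 0 :=
      h0.filter_mono (nhds_le_nhdsSet hm)
    have h2 : Tendsto (fun y : Z × (ℂ × W) => (y.1, y.2.2)) (𝓝 (z, u, w)) (𝓝 (z, w)) :=
      Continuous.tendsto (by fun_prop) (z, u, w)
    exact h2.eventually h1
  have hne : ∀ x : Z × (ℂ × W), x.2.1 ≠ p x.1 → ∀ᶠ y : Z × (ℂ × W) in 𝓝 x, y.2.1 - p y.1 ≠ 0 := by
    intro x hx
    have : Continuous (fun p' : Z × (ℂ × W) => p'.2.1 - p p'.1) := by fun_prop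
    exact this.continuousAt.eventually_ne (sub_ne_zero.2 hx)
  refine ⟨C, ?_, ?_⟩
  · rw [hol_iff]
    intro x0 hx0
    by_cases hgood : x0.2.1 = p x0.1
    · let ψ : (Z × (ℂ × W)) × ℂ → Z × (ℂ × W) := fun q => (q.1.1, (q.2 + p q.1.1, q.1.2.2))
      have hψd : Differentiable ℂ ψ := by
        have h1 : Differentiable ℂ (fun q : (Z × (ℂ × W)) × ℂ => p q.1.1) :=
          hp.comp (by fun_prop)
        exact Differentiable.prodMk (by fun_prop)
          (Differentiable.prodMk (Differentiable.add (by fun_prop) h1) (by fun_prop))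
      have hψ0 : ψ (x0, 0) = x0 := by
        simp [ψ, ← hgood]
      have hev : ∀ᶠ q in 𝓝 (x0, (0 : ℂ)), ∀ᶠ q' in 𝓝 q, DifferentiableAt ℂ G (ψ q') := by
        have h1 := hG.ev hx0
        rw [← hψ0] at h1
        exact ((hψd.continuous.tendsto (x0, 0)).eventually h1).eventually_nhds
      obtain ⟨ρ, hρ, hball⟩ := Metric.eventually_nhds_iff_ball.1 hev
      have hball' : ∀ x ∈ ball x0 ρ, ∀ t ∈ ball (0 : ℂ) ρ,
          ∀ᶠ q' in 𝓝 (x, t), DifferentiableAt ℂ G (ψ q') := by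
        intro x hx t ht
        exact hball (x, t) (by rw [← ball_prod_same]; exact ⟨hx, ht⟩)
      let r := ρ / 2
      have hr : 0 < r := by positivity
      have hrρ : r < ρ := by simp only [r]; linarith
      let Φ : (Z × (ℂ × W)) × ℂ → ℂ := fun q =>
        (2 * Real.pi * I)⁻¹ * ((q.2 - (q.1.2.1 - p q.1.1))⁻¹ * (q.2⁻¹ * G (ψ q)))
      have hJ := paramInt_ev Φ (circleMap 0 r) (fun θ => deriv (circleMap 0 r) θ)
        (continuous_circleMap 0 r) (by simp only [deriv_circleMap]; fun_prop) 0 (2 * Real.pi) x0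
        (by
          intro θ _
          have hn : ‖circleMap 0 r θ‖ = r := by simp [abs_of_pos hr]
          have hc0 : circleMap 0 r θ ≠ 0 := by
            intro h; rw [h] at hn; simp at hn; linarith
          have h1 := hball' x0 (mem_ball_self hρ) (circleMap 0 r θ) (by simpa [hn] using hrρ)
          have h2 : ∀ᶠ q : (Z × (ℂ × W)) × ℂ in 𝓝 (x0, circleMap 0 r θ), q.2 ≠ 0 :=
            continuous_snd.continuousAt.eventually_ne hc0
          have h3 : ∀ᶠ q : (Z × (ℂ × W)) × ℂ in 𝓝 (x0, circleMap 0 r θ),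
              q.2 - (q.1.2.1 - p q.1.1) ≠ 0 := by
            have : Continuous (fun q : (Z × (ℂ × W)) × ℂ => q.2 - (q.1.2.1 - p q.1.1)) := by
              fun_prop
            exact this.continuousAt.eventually_ne (by simpa [hgood] using hc0)
          filter_upwards [h1, h2, h3] with q hq1 hq2 hq3
          have d1 : DifferentiableAt ℂ (fun q => G (ψ q)) q := hq1.comp q (hψd q)
          have d2 : DifferentiableAt ℂ (fun q : (Z × (ℂ × W)) × ℂ => q.2⁻¹) q :=
            differentiableAt_snd.fun_inv hq2
          have d3' : DifferentiableAt ℂ (fun q : (Z × (ℂ × W)) × ℂ => p q.1.1) q :=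
            (hp.comp (f := fun q : (Z × (ℂ × W)) × ℂ => q.1.1) (by fun_prop)) q
          have d3 : DifferentiableAt ℂ
              (fun q : (Z × (ℂ × W)) × ℂ => (q.2 - (q.1.2.1 - p q.1.1))⁻¹) q :=
            DifferentiableAt.fun_inv (by fun_prop) hq3
          exact (d3.fun_mul (d2.fun_mul d1)).const_mul _)
      have hsmall : ∀ᶠ x : Z × (ℂ × W) in 𝓝 x0, x.2.1 - p x.1 ∈ ball (0 : ℂ) r := by
        have : Continuous (fun p' : Z × (ℂ × W) => p'.2.1 - p p'.1) := by fun_prop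
        exact this.continuousAt.eventually_mem (isOpen_ball.mem_nhds (by simpa [hgood] using hr))
      have hCJ : ∀ᶠ x in 𝓝 x0, C x = ∫ θ in (0 : ℝ)..(2 * Real.pi),
          deriv (circleMap 0 r) θ * Φ (x, circleMap 0 r θ) := by
        filter_upwards [hsmall, hvan x0 hx0 hgood, ball_mem_nhds x0 hρ] with x hx1 hx2 hx3
        set f : ℂ → ℂ := fun t => G (x.1, (t + p x.1, x.2.2)) with hf
        have hfd : DifferentiableOn ℂ f (closedBall 0 r) := by
          intro t ht
          have h1 := (hball' x hx3 t (closedBall_subset_ball hrρ ht)).self_of_nhds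
          have h2 : DifferentiableAt ℂ (fun t => ψ (x, t)) t :=
            (hψd (x, t)).comp t (f := fun t => (x, t)) (by fun_prop)
          exact (h1.comp t h2).differentiableWithinAt
        have hf0 : f 0 = 0 := by simpa [hf] using hx2
        have hg : DifferentiableOn ℂ (dslope f 0) (closedBall 0 r) :=
          (differentiableOn_dslope (closedBall_mem_nhds 0 hr)).2 hfd
        have key := hg.circleIntegral_sub_inv_smul hx1
        have hCx : C x = dslope f 0 (x.2.1 - p x.1) := by
          by_cases hc : x.2.1 = p x.1
          · simp only [C, if_pos hc, hc, sub_self, dslope_same, hf]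
          · rw [dslope_of_ne f (sub_ne_zero.2 hc), slope_def_field, hf0]
            simp [C, if_neg hc, hf]
        rw [smul_eq_mul] at key
        have hpi : (2 * Real.pi * I : ℂ) ≠ 0 := Complex.two_pi_I_ne_zero
        rw [hCx, ← mul_right_inj' hpi, ← key, circleIntegral,
          ← intervalIntegral.integral_const_mul]
        apply intervalIntegral.integral_congr
        intro θ _
        have hn : ‖circleMap 0 r θ‖ = r := by simp [abs_of_pos hr]
        have hc0 : circleMap 0 r θ ≠ 0 := by
          intro h; rw [h] at hn; simp at hn; linarith
        simp only [smul_eq_mul, Φ]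
        rw [dslope_of_ne f hc0, slope_def_field, hf0]
        simp only [hf, ψ, sub_zero]
        field_simp
      filter_upwards [hJ, hCJ.eventually_nhds] with x h1 h2
      exact h1.congr_of_eventuallyEq h2
    · have h1 := hne x0 hgood
      have h2 : C =ᶠ[𝓝 x0] fun x => G x * (x.2.1 - p x.1)⁻¹ := by
        filter_upwards [h1] with x hx
        simp [C, if_neg (sub_ne_zero.1 hx), div_eq_mul_inv]
      filter_upwards [hG.ev hx0, h1, h2.eventually_nhds] with x h3 h4 h5
      have d3' : DifferentiableAt ℂ (fun q : Z × (ℂ × W) => p q.1) x :=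
        (hp.comp (f := fun q : Z × (ℂ × W) => q.1) (by fun_prop)) x
      have d4 : DifferentiableAt ℂ (fun x : Z × (ℂ × W) => (x.2.1 - p x.1)⁻¹) x :=
        DifferentiableAt.fun_inv (by fun_prop) h4
      exact (h3.fun_mul d4).congr_of_eventuallyEq h5
  · rw [eventually_nhdsSet_iff_forall]
    intro x0 hx0
    by_cases hgood : x0.2.1 = p x0.1
    · filter_upwards [hvan x0 hx0 hgood] with x hx
      by_cases hc : x.2.1 = p x.1
      · rw [hc, sub_self, zero_mul, ← hx, ← hc]
      · have := sub_ne_zero.2 hc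
        simp only [C, if_neg hc]; field_simp
    · filter_upwards [hne x0 hgood] with x hx
      simp only [C, if_neg (sub_ne_zero.1 hx)]; field_simp

end
end OkaWeil

namespace OkaWeil
open Set Filter Topology Metric Complex

variable {n : ℕ}

/-- real coordinates on `ℂⁿ` -/
noncomputable def rho (j : Fin n × Bool) (z : Fin n → ℂ) : ℝ :=
  if j.2 then (z j.1).im else (z j.1).re

def box (a b : Fin n × Bool → ℝ) : Set (Fin n → ℂ) := {z | ∀ j, rho j z ∈ Icc (a j) (b j)}

/-- polyhedron defined by `|p| ≤ 1`. -/
def PP (ps : List ((Fin n → ℂ) → ℂ)) : Set (Fin n → ℂ) := {z | ∀ p ∈ ps, p z ∈ closedBall (0 : ℂ) 1}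

lemma rho_cont (j : Fin n × Bool) : Continuous (rho j) := by
  unfold rho
  rcases j with ⟨i, b⟩
  cases b
  · simp only [Bool.false_eq_true, if_false]; fun_prop
  · simp only [if_true]; fun_prop

lemma box_eq (a b : Fin n × Bool → ℝ) : box a b =
    Set.univ.pi fun i => Icc (a (i, false)) (b (i, false)) ×ℂ Icc (a (i, true)) (b (i, true)) := by
  ext z
  simp only [box, mem_ofPred_eq, Prod.forall, Bool.forall_bool, rho, Set.mem_pi, mem_univ, true_imp_iff,
    mem_reProdIm]
  simp

lemma box_compact (a b : Fin n × Bool → ℝ) : IsCompact (box a b) := by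
  rw [box_eq]
  exact isCompact_univ_pi fun i => isCompact_Icc.reProdIm isCompact_Icc

lemma PP_closed (ps : List ((Fin n → ℂ) → ℂ)) (hps : ∀ p ∈ ps, Differentiable ℂ p) :
    IsClosed (PP ps) := by
  have : PP ps = ⋂ p ∈ ps, p ⁻¹' closedBall (0 : ℂ) 1 := by
    ext z; simp [PP]
  rw [this]
  exact isClosed_iInter fun p => isClosed_iInter fun hp =>
    isClosed_closedBall.preimage (hps p hp).continuous

def CousinP (ps : List ((Fin n → ℂ) → ℂ)) : Prop :=
  ∀ (W : Type) [NormedAddCommGroup W] [NormedSpace ℂ W] [FiniteDimensional ℂ W] (DW : Set W),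
    IsCompact DW → ∀ (a b : Fin n × Bool → ℝ) (j : Fin n × Bool) (s : ℝ) (h : (Fin n → ℂ) × W → ℂ),
    Hol h ((box a b ∩ {z | rho j z = s} ∩ PP ps) ×ˢ DW) →
    ∃ h1 h2 : (Fin n → ℂ) × W → ℂ,
      Hol h1 ((box a b ∩ {z | rho j z ≤ s} ∩ PP ps) ×ˢ DW) ∧
      Hol h2 ((box a b ∩ {z | s ≤ rho j z} ∩ PP ps) ×ˢ DW) ∧
      ∀ᶠ x in 𝓝ˢ ((box a b ∩ {z | rho j z = s} ∩ PP ps) ×ˢ DW), h x = h1 x - h2 x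

lemma cousin_nil : CousinP ([] : List ((Fin n → ℂ) → ℂ)) := by
  intro W _ _ _ DW hDW a b j s h hh
  have hPP : PP ([] : List ((Fin n → ℂ) → ℂ)) = univ := by ext; simp [PP]
  rw [hPP] at hh ⊢
  simp only [inter_univ] at hh ⊢
  by_cases hemp : (box a b ∩ {z | rho j z = s}) = ∅
  · refine ⟨fun _ => 0, fun _ => 0, Eventually.of_forall (fun x => differentiableAt_const _),
      Eventually.of_forall (fun x => differentiableAt_const _), ?_⟩
    rw [hemp]; simp
  obtain ⟨z0, hz0, hz0s⟩ := nonempty_iff_ne_empty.2 hemp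
  have hs : s ∈ Icc (a j) (b j) := by rw [← show rho j z0 = s from hz0s]; exact hz0 j
  have hab : ∀ j, a j ≤ b j := fun j => (hz0 j).1.trans (hz0 j).2
  obtain ⟨i, β⟩ := j
  let ℓ : (Fin n → ℂ) × W →L[ℂ] ℂ :=
    (ContinuousLinearMap.proj (R := ℂ) (φ := fun _ : Fin n => ℂ) i).comp
      (ContinuousLinearMap.fst ℂ (Fin n → ℂ) W)
  have hℓ : ∀ x, ℓ x = x.1 i := fun x => rfl
  let e : (Fin n → ℂ) × W := (Pi.single i 1, 0)
  have hr1 : ∀ x ζ, repl ℓ e (x, ζ) = (Function.update x.1 i ζ, x.2) := by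
    intro x ζ
    ext k
    · simp only [repl, e, hℓ]
      by_cases hk : k = i
      · subst hk; simp
      · simp [hk]
    · simp [repl, e]
  have hT : IsCompact (box a b ×ˢ DW) := (box_compact a b).prod hDW
  cases β
  · obtain ⟨η, hη, IB, IR, IT, IL, h1, h2, h3, h4, h5⟩ := cousin4 ℓ e (box a b ×ˢ DW) hT s s
      (a (i, true)) (b (i, true)) le_rfl (hab _) h (by
        rintro ⟨z, w⟩ ⟨hz, hw⟩ ζ hζ
        rw [hr1]
        refine hh.ev ⟨⟨?_, ?_⟩, hw⟩
        · rintro ⟨k, γ⟩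
          by_cases hk : k = i
          · subst hk
            cases γ
            · simpa [rho, show ζ.re = s by simpa using hζ.1] using hs
            · simpa [rho] using hζ.2
          · have := hz (k, γ)
            simpa [rho, Function.update_of_ne hk] using this
        · simpa [rho] using hζ.1)
    refine ⟨fun x => IB x + IR x + IT x, fun x => - IL x, ?_, ?_, ?_⟩
    · rw [hol_iff]
      rintro ⟨z, w⟩ ⟨⟨hz, hzs⟩, hw⟩
      have hb := hz (i, true)
      simp only [rho, mem_ofPred_eq, if_true, Bool.false_eq_true, if_false, mem_Icc] at hzs hb
      filter_upwards [h1 (z, w) ⟨hz, hw⟩ (by simp only [hℓ]; linarith),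
        h2 (z, w) ⟨hz, hw⟩ (by simp only [hℓ]; linarith),
        h3 (z, w) ⟨hz, hw⟩ (by simp only [hℓ]; linarith)] with x d1 d2 d3
      exact (d1.fun_add d2).fun_add d3
    · rw [hol_iff]
      rintro ⟨z, w⟩ ⟨⟨hz, hzs⟩, hw⟩
      simp only [rho, mem_ofPred_eq, Bool.false_eq_true, if_false] at hzs
      filter_upwards [h4 (z, w) ⟨hz, hw⟩ (by simp only [hℓ]; linarith)] with x d1
      exact d1.fun_neg
    · rw [eventually_nhdsSet_iff_forall]
      rintro ⟨z, w⟩ ⟨⟨hz, hzs⟩, hw⟩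
      have hb := hz (i, true)
      simp only [rho, mem_ofPred_eq, if_true, Bool.false_eq_true, if_false, mem_Icc] at hzs hb
      filter_upwards [h5 (z, w) ⟨hz, hw⟩ (by
        rw [mem_reProdIm, hℓ]; exact ⟨by simp [hzs], hb⟩)] with x hx
      rw [hx]; ring
  · obtain ⟨η, hη, IB, IR, IT, IL, h1, h2, h3, h4, h5⟩ := cousin4 ℓ e (box a b ×ˢ DW) hT
      (a (i, false)) (b (i, false)) s s (hab _) le_rfl h (by
        rintro ⟨z, w⟩ ⟨hz, hw⟩ ζ hζ
        rw [hr1]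
        refine hh.ev ⟨⟨?_, ?_⟩, hw⟩
        · rintro ⟨k, γ⟩
          by_cases hk : k = i
          · subst hk
            cases γ
            · simpa [rho] using hζ.1
            · simpa [rho, show ζ.im = s by simpa using hζ.2] using hs
          · have := hz (k, γ)
            simpa [rho, Function.update_of_ne hk] using this
        · simpa [rho] using hζ.2)
    refine ⟨fun x => IL x + IR x + IT x, fun x => - IB x, ?_, ?_, ?_⟩
    · rw [hol_iff]
      rintro ⟨z, w⟩ ⟨⟨hz, hzs⟩, hw⟩
      have hb := hz (i, false)
      simp only [rho, mem_ofPred_eq, if_true, Bool.false_eq_true, if_false, mem_Icc] at hzs hb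
      filter_upwards [h4 (z, w) ⟨hz, hw⟩ (by simp only [hℓ]; linarith),
        h2 (z, w) ⟨hz, hw⟩ (by simp only [hℓ]; linarith),
        h3 (z, w) ⟨hz, hw⟩ (by simp only [hℓ]; linarith)] with x d1 d2 d3
      exact (d1.fun_add d2).fun_add d3
    · rw [hol_iff]
      rintro ⟨z, w⟩ ⟨⟨hz, hzs⟩, hw⟩
      simp only [rho, mem_ofPred_eq, if_true] at hzs
      filter_upwards [h1 (z, w) ⟨hz, hw⟩ (by simp only [hℓ]; linarith)] with x d1
      exact d1.fun_neg
    · rw [eventually_nhdsSet_iff_forall]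
      rintro ⟨z, w⟩ ⟨⟨hz, hzs⟩, hw⟩
      have hb := hz (i, false)
      simp only [rho, mem_ofPred_eq, if_true, Bool.false_eq_true, if_false, mem_Icc] at hzs hb
      filter_upwards [h5 (z, w) ⟨hz, hw⟩ (by
        rw [mem_reProdIm, hℓ]; exact ⟨hb, by simp [hzs]⟩)] with x hx
      rw [hx]; ring

end OkaWeil

namespace OkaWeil
open Set Filter Topology Metric Complex

variable {n : ℕ}

lemma box_le (a b : Fin n × Bool → ℝ) (j : Fin n × Bool) (s : ℝ) :
    box a b ∩ {z | rho j z ≤ s} = box a (Function.update b j (min (b j) s)) := by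
  ext z
  simp only [box, mem_inter_iff, mem_ofPred_eq, mem_Icc]
  constructor
  · rintro ⟨h1, h2⟩ k
    by_cases hk : k = j
    · subst hk; simp [h1 k, h2]
    · simpa [hk] using h1 k
  · intro h
    have hj := h j
    simp only [Function.update_self, le_min_iff] at hj
    refine ⟨fun k => ?_, hj.2.2⟩
    by_cases hk : k = j
    · subst hk; exact ⟨hj.1, hj.2.1⟩
    · simpa [hk] using h k

lemma box_ge (a b : Fin n × Bool → ℝ) (j : Fin n × Bool) (s : ℝ) :
    box a b ∩ {z | s ≤ rho j z} = box (Function.update a j (max (a j) s)) b := by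
  ext z
  simp only [box, mem_inter_iff, mem_ofPred_eq, mem_Icc]
  constructor
  · rintro ⟨h1, h2⟩ k
    by_cases hk : k = j
    · subst hk; simp [h1 k, h2]
    · simpa [hk] using h1 k
  · intro h
    have hj := h j
    simp only [Function.update_self, max_le_iff] at hj
    refine ⟨fun k => ?_, hj.1.2⟩
    by_cases hk : k = j
    · subst hk; exact ⟨hj.1.1, hj.2⟩
    · simpa [hk] using h k

section lift
variable {W : Type} [NormedAddCommGroup W] [NormedSpace ℂ W] [FiniteDimensional ℂ W]

def Good (ps : List ((Fin n → ℂ) → ℂ)) (p : (Fin n → ℂ) → ℂ) (DW : Set W)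
    (f : (Fin n → ℂ) × W → ℂ) (B : Set (Fin n → ℂ)) : Prop :=
  ∃ F : (Fin n → ℂ) × (ℂ × W) → ℂ, Hol F ((B ∩ PP ps) ×ˢ (closedBall (0 : ℂ) 1 ×ˢ DW)) ∧
    ∀ᶠ x in 𝓝ˢ ((B ∩ PP ps ∩ p ⁻¹' closedBall (0 : ℂ) 1) ×ˢ DW), F (x.1, (p x.1, x.2)) = f x

lemma good_merge (ps : List ((Fin n → ℂ) → ℂ)) (hps : ∀ p ∈ ps, Differentiable ℂ p)
    (hC : CousinP ps) (p : (Fin n → ℂ) → ℂ) (hp : Differentiable ℂ p) (DW : Set W)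
    (hDW : IsCompact DW) (f : (Fin n → ℂ) × W → ℂ) (a b : Fin n × Bool → ℝ) (j : Fin n × Bool)
    (s : ℝ) (h1 : Good ps p DW f (box a b ∩ {z | rho j z ≤ s}))
    (h2 : Good ps p DW f (box a b ∩ {z | s ≤ rho j z})) : Good ps p DW f (box a b) := by
  obtain ⟨F1, hF1, hf1⟩ := h1
  obtain ⟨F2, hF2, hf2⟩ := h2
  have hclo := PP_closed ps hps
  have hle : IsClosed {z | rho j z ≤ s} := isClosed_le (rho_cont j) continuous_const
  have hge : IsClosed {z | s ≤ rho j z} := isClosed_le continuous_const (rho_cont j)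
  have hD : IsCompact (closedBall (0 : ℂ) 1 ×ˢ DW) := (isCompact_closedBall 0 1).prod hDW
  set X1 := (box a b ∩ {z | rho j z ≤ s} ∩ PP ps) ×ˢ (closedBall (0 : ℂ) 1 ×ˢ DW) with hX1
  set X2 := (box a b ∩ {z | s ≤ rho j z} ∩ PP ps) ×ˢ (closedBall (0 : ℂ) 1 ×ˢ DW) with hX2
  set X0 := (box a b ∩ {z | rho j z = s} ∩ PP ps) ×ˢ (closedBall (0 : ℂ) 1 ×ˢ DW) with hX0
  have hX1c : IsCompact X1 := (((box_compact a b).inter_right hle).inter_right hclo).prod hD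
  have hX2c : IsCompact X2 := (((box_compact a b).inter_right hge).inter_right hclo).prod hD
  have h01 : X0 ⊆ X1 := by
    rintro ⟨z, u⟩ ⟨⟨⟨hz, hs⟩, hP⟩, hu⟩
    exact ⟨⟨⟨hz, le_of_eq hs⟩, hP⟩, hu⟩
  have h02 : X0 ⊆ X2 := by
    rintro ⟨z, u⟩ ⟨⟨⟨hz, hs⟩, hP⟩, hu⟩
    exact ⟨⟨⟨hz, ge_of_eq hs⟩, hP⟩, hu⟩
  have h12 : X1 ∩ X2 ⊆ X0 := by
    rintro ⟨z, u⟩ ⟨⟨⟨⟨hz, hs⟩, hP⟩, hu⟩, ⟨⟨⟨-, hs'⟩, -⟩, -⟩⟩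
    exact ⟨⟨⟨hz, le_antisymm hs hs'⟩, hP⟩, hu⟩
  obtain ⟨C, hCh, hCe⟩ := division (fun x => F1 x - F2 x) p hp (box a b ∩ {z | rho j z = s} ∩ PP ps)
    (closedBall (0 : ℂ) 1) DW ((hF1.mono h01).sub (hF2.mono h02)) (by
      have e1 := hf1.filter_mono (nhdsSet_mono (s := (box a b ∩ {z | rho j z = s} ∩ PP ps ∩
        p ⁻¹' closedBall 0 1) ×ˢ DW) (by
          rintro ⟨z, u⟩ ⟨⟨⟨⟨hz, hs⟩, hP⟩, hp⟩, hu⟩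
          exact ⟨⟨⟨⟨hz, le_of_eq hs⟩, hP⟩, hp⟩, hu⟩))
      have e2 := hf2.filter_mono (nhdsSet_mono (s := (box a b ∩ {z | rho j z = s} ∩ PP ps ∩
        p ⁻¹' closedBall 0 1) ×ˢ DW) (by
          rintro ⟨z, u⟩ ⟨⟨⟨⟨hz, hs⟩, hP⟩, hp⟩, hu⟩
          exact ⟨⟨⟨⟨hz, ge_of_eq hs⟩, hP⟩, hp⟩, hu⟩))
      filter_upwards [e1, e2] with x hx1 hx2
      rw [hx1, hx2, sub_self])
  obtain ⟨k1, k2, hk1, hk2, hk⟩ := hC (ℂ × W) (closedBall (0 : ℂ) 1 ×ˢ DW) hD a b j s C hCh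
  have hup : Differentiable ℂ (fun x : (Fin n → ℂ) × (ℂ × W) => x.2.1 - p x.1) := by
    have : Differentiable ℂ (fun x : (Fin n → ℂ) × (ℂ × W) => p x.1) := hp.comp (by fun_prop)
    exact Differentiable.fun_sub (by fun_prop) this
  obtain ⟨F, hFe1, hFe2⟩ := glue hX1c hX2c (fun x => F1 x - (x.2.1 - p x.1) * k1 x)
    (fun x => F2 x - (x.2.1 - p x.1) * k2 x) (by
      have e1 := hCe.filter_mono (nhdsSet_mono h12)
      have e2 := hk.filter_mono (nhdsSet_mono h12)
      filter_upwards [e1, e2] with x hx1 hx2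
      rw [hx2] at hx1
      linear_combination hx1)
  have hH1 : Hol F X1 := (hF1.sub ((Differentiable.hol hup X1).mul hk1)).congr hFe1
  have hH2 : Hol F X2 := (hF2.sub ((Differentiable.hol hup X2).mul hk2)).congr hFe2
  refine ⟨F, ?_, ?_⟩
  · rw [hol_iff] at hH1 hH2 ⊢
    rintro ⟨z, u⟩ ⟨⟨hz, hP⟩, hu⟩
    rcases le_total (rho j z) s with hs | hs
    · exact hH1 _ ⟨⟨⟨hz, hs⟩, hP⟩, hu⟩
    · exact hH2 _ ⟨⟨⟨hz, hs⟩, hP⟩, hu⟩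
  · rw [eventually_nhdsSet_iff_forall] at hFe1 hFe2 hf1 hf2 ⊢
    have hpc := hp.continuous
    have hφ : Continuous (fun y : (Fin n → ℂ) × W => (y.1, (p y.1, y.2))) := by fun_prop
    rintro ⟨z, w⟩ ⟨⟨⟨hz, hP⟩, hpz⟩, hw⟩
    rcases le_total (rho j z) s with hs | hs
    · have e1 := (hφ.tendsto (z, w)).eventually (hFe1 (z, (p z, w)) ⟨⟨⟨hz, hs⟩, hP⟩, hpz, hw⟩)
      filter_upwards [e1, hf1 (z, w) ⟨⟨⟨⟨hz, hs⟩, hP⟩, hpz⟩, hw⟩] with y hy1 hy2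
      rw [hy1, hy2]; simp
    · have e1 := (hφ.tendsto (z, w)).eventually (hFe2 (z, (p z, w)) ⟨⟨⟨hz, hs⟩, hP⟩, hpz, hw⟩)
      filter_upwards [e1, hf2 (z, w) ⟨⟨⟨⟨hz, hs⟩, hP⟩, hpz⟩, hw⟩] with y hy1 hy2
      rw [hy1, hy2]; simp

lemma good_local (ps : List ((Fin n → ℂ) → ℂ)) (hps : ∀ p ∈ ps, Differentiable ℂ p)
    (p : (Fin n → ℂ) → ℂ) (hp : Differentiable ℂ p) (DW : Set W)
    (hDW : IsCompact DW) (f : (Fin n → ℂ) × W → ℂ) (Q : Set (Fin n → ℂ)) (hQ : IsCompact Q)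
    (hf : Hol f ((Q ∩ PP ps ∩ p ⁻¹' closedBall (0 : ℂ) 1) ×ˢ DW)) (z : Fin n → ℂ) :
    ∃ N : Set (Fin n → ℂ), IsOpen N ∧ z ∈ N ∧ ∀ B ⊆ N ∩ Q, Good ps p DW f B := by
  by_cases hz : z ∈ Q ∩ PP ps ∩ p ⁻¹' closedBall (0 : ℂ) 1
  · obtain ⟨u, v, huo, hvo, hxu, hγv, huv⟩ := generalized_tube_lemma
      (isCompact_singleton (x := z)) hDW
      (isOpen_setOfPred_eventually_nhds : IsOpen {y | ∀ᶠ y' in 𝓝 y, DifferentiableAt ℂ f y'})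
      (by
        rintro ⟨z', w⟩ ⟨hz', hw⟩
        have hz' : z' = z := hz'
        subst hz'
        exact hf.ev ⟨hz, hw⟩)
    refine ⟨u, huo, hxu rfl, fun B hB => ⟨fun x => f (x.1, x.2.2), ?_, Eventually.of_forall ?_⟩⟩
    · have hfu : Hol f (u ×ˢ DW) := hol_iff.2 fun x hx => huv ⟨hx.1, hγv hx.2⟩
      refine hfu.comp (φ := fun x : (Fin n → ℂ) × (ℂ × W) => (x.1, x.2.2)) (by fun_prop) ?_
      rintro ⟨z, u, w⟩ ⟨⟨hz, -⟩, -, hw⟩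
      exact ⟨(hB hz).1, hw⟩
    · intro x; rfl
  · refine ⟨(Q ∩ PP ps ∩ p ⁻¹' closedBall (0 : ℂ) 1)ᶜ, ?_, hz, fun B hB =>
      ⟨fun _ => 0, Eventually.of_forall (fun x => differentiableAt_const _), ?_⟩⟩
    · exact ((hQ.isClosed.inter (PP_closed ps hps)).inter
        (isClosed_closedBall.preimage hp.continuous)).isOpen_compl
    · have : B ∩ PP ps ∩ p ⁻¹' closedBall (0 : ℂ) 1 = ∅ := by
        rw [eq_empty_iff_forall_notMem]
        rintro x ⟨⟨hx, hP⟩, hpx⟩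
        exact (hB hx).1 ⟨⟨(hB hx).2, hP⟩, hpx⟩
      rw [this]; simp

lemma lift (ps : List ((Fin n → ℂ) → ℂ)) (hps : ∀ p ∈ ps, Differentiable ℂ p)
    (hC : CousinP ps) (p : (Fin n → ℂ) → ℂ) (hp : Differentiable ℂ p) (DW : Set W)
    (hDW : IsCompact DW) (f : (Fin n → ℂ) × W → ℂ) (a b : Fin n × Bool → ℝ)
    (hf : Hol f ((box a b ∩ PP ps ∩ p ⁻¹' closedBall (0 : ℂ) 1) ×ˢ DW)) :
    Good ps p DW f (box a b) := by
  classical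
  choose N hNo hzN hN using good_local ps hps p hp DW hDW f (box a b) (box_compact a b) hf
  obtain ⟨δ, hδ, hleb⟩ := lebesgue_number_lemma_of_metric (box_compact a b) hNo
    (fun z _ => mem_iUnion.2 ⟨z, hzN z⟩)
  -- small boxes
  have hsmall : ∀ a' b', box a' b' ⊆ box a b → (∀ j, b' j - a' j ≤ δ / 4) →
      Good ps p DW f (box a' b') := by
    intro a' b' hsub hw
    rcases (box a' b').eq_empty_or_nonempty with he | ⟨z, hz⟩
    · exact hN 0 _ (by rw [he]; exact empty_subset _)
    · obtain ⟨i, hi⟩ := hleb z (hsub hz)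
      refine hN i _ fun y hy => ⟨hi ?_, hsub hy⟩
      rw [mem_ball]
      refine lt_of_le_of_lt ?_ (show δ / 2 < δ by linarith)
      rw [dist_pi_le_iff (by positivity)]
      intro k
      rw [dist_eq_norm]
      refine (Complex.norm_le_abs_re_add_abs_im _).trans ?_
      have h1 : ∀ c : Bool, |rho (k, c) y - rho (k, c) z| ≤ δ / 4 := by
        intro c
        have h1 := hy (k, c)
        have h2 := hz (k, c)
        have h3 := hw (k, c)
        rw [abs_le]
        constructor <;> linarith [h1.1, h1.2, h2.1, h2.2]
      have h2 := h1 false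
      have h3 := h1 true
      simp only [rho, if_true, Bool.false_eq_true, if_false] at h2 h3
      rw [Complex.sub_re, Complex.sub_im]
      linarith
  have hmain : ∀ T : Finset (Fin n × Bool), ∀ a' b', box a' b' ⊆ box a b →
      (∀ j ∉ T, b' j - a' j ≤ δ / 4) → Good ps p DW f (box a' b') := by
    intro T
    induction T using Finset.induction_on with
    | empty => intro a' b' h1 h2; exact hsmall a' b' h1 fun j => h2 j (by simp)
    | insert j T hj ih =>
      have hinner : ∀ M : ℕ, ∀ a' b', box a' b' ⊆ box a b → b' j - a' j ≤ 2 ^ M * (δ / 4) →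
          (∀ k ∉ insert j T, b' k - a' k ≤ δ / 4) → Good ps p DW f (box a' b') := by
        intro M
        induction M with
        | zero =>
          intro a' b' h1 h2 h3
          refine ih a' b' h1 fun k hk => ?_
          by_cases hkj : k = j
          · subst hkj; simpa using h2
          · exact h3 k (by simp [hkj, hk])
        | succ M ihM =>
          intro a' b' h1 h2 h3
          have hw : (a' j + b' j) / 2 - a' j ≤ 2 ^ M * (δ / 4) := by
            rw [pow_succ] at h2; linarith
          have hw' : b' j - (a' j + b' j) / 2 ≤ 2 ^ M * (δ / 4) := by
            rw [pow_succ] at h2; linarith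
          refine good_merge ps hps hC p hp DW hDW f a' b' j ((a' j + b' j) / 2) ?_ ?_
          · have hs := inter_subset_left.trans h1 (a := box a' b' ∩ {z | rho j z ≤ (a' j + b' j) / 2})
            rw [box_le] at hs ⊢
            refine ihM _ _ hs ?_ ?_
            · simp only [Function.update_self]
              exact le_trans (by gcongr; exact min_le_right _ _) hw
            · intro k hk
              have : k ≠ j := by rintro rfl; simp at hk
              simpa [this] using h3 k hk
          · have hs := inter_subset_left.trans h1 (a := box a' b' ∩ {z | (a' j + b' j) / 2 ≤ rho j z})
            rw [box_ge] at hs ⊢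
            refine ihM _ _ hs ?_ ?_
            · simp only [Function.update_self]
              exact le_trans (by gcongr; exact le_max_right _ _) hw'
            · intro k hk
              have : k ≠ j := by rintro rfl; simp at hk
              simpa [this] using h3 k hk
      intro a' b' h1 h2
      obtain ⟨M, hM⟩ := pow_unbounded_of_one_lt ((b' j - a' j) / (δ / 4)) (one_lt_two (α := ℝ))
      refine hinner M a' b' h1 ?_ h2
      rw [div_lt_iff₀ (by positivity)] at hM
      exact hM.le
  exact hmain Finset.univ a b Subset.rfl (by simp)

end lift

lemma PP_cons (p : (Fin n → ℂ) → ℂ) (ps : List ((Fin n → ℂ) → ℂ)) :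
    PP (p :: ps) = PP ps ∩ p ⁻¹' closedBall (0 : ℂ) 1 := by
  ext z; simp [PP, and_comm]

lemma cousin_cons (ps : List ((Fin n → ℂ) → ℂ)) (hps : ∀ p ∈ ps, Differentiable ℂ p)
    (hC : CousinP ps) (p : (Fin n → ℂ) → ℂ) (hp : Differentiable ℂ p) : CousinP (p :: ps) := by
  intro W _ _ _ DW hDW a b j s h hh
  rw [PP_cons, ← inter_assoc] at hh
  simp only [PP_cons, ← inter_assoc]
  have hslice : box a b ∩ {z | rho j z = s} =
      box (Function.update a j (max (a j) s)) (Function.update b j (min (b j) s)) := by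
    have := box_ge a (Function.update b j (min (b j) s)) j s
    rw [← this, ← box_le]
    ext z
    constructor
    · rintro ⟨h1, h2⟩
      exact ⟨⟨h1, le_of_eq h2⟩, ge_of_eq h2⟩
    · rintro ⟨⟨h1, h2⟩, h3⟩
      exact ⟨h1, le_antisymm h2 h3⟩
  have hL := lift ps hps hC p hp DW hDW h (Function.update a j (max (a j) s))
    (Function.update b j (min (b j) s)) (by rw [← hslice]; exact hh)
  rw [← hslice] at hL
  obtain ⟨H, hH, hHh⟩ := hL
  obtain ⟨k1, k2, hk1, hk2, hk⟩ := hC (ℂ × W) (closedBall (0 : ℂ) 1 ×ˢ DW)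
    ((isCompact_closedBall 0 1).prod hDW) a b j s H hH
  have hφ : Differentiable ℂ (fun y : (Fin n → ℂ) × W => (y.1, (p y.1, y.2))) := by
    have h1 : Differentiable ℂ (fun q : (Fin n → ℂ) × W => p q.1) := hp.comp (by fun_prop)
    exact Differentiable.prodMk (by fun_prop) (Differentiable.prodMk h1 (by fun_prop))
  refine ⟨_, _, hk1.comp hφ ?_, hk2.comp hφ ?_, ?_⟩
  · rintro ⟨z, w⟩ ⟨⟨hz, hpz⟩, hw⟩
    exact ⟨hz, hpz, hw⟩
  · rintro ⟨z, w⟩ ⟨⟨hz, hpz⟩, hw⟩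
    exact ⟨hz, hpz, hw⟩
  · have := (hφ.continuous.tendsto_nhdsSet (s := (box a b ∩ {z | rho j z = s} ∩ PP ps ∩
      p ⁻¹' closedBall (0 : ℂ) 1) ×ˢ DW) (t := (box a b ∩ {z | rho j z = s} ∩ PP ps) ×ˢ
        (closedBall (0 : ℂ) 1 ×ˢ DW)) (by
      rintro ⟨z, w⟩ ⟨⟨hz, hpz⟩, hw⟩
      exact ⟨hz, hpz, hw⟩)).eventually hk
    filter_upwards [this, hHh] with x hx1 hx2
    rw [← hx1, hx2]

lemma cousin_all (ps : List ((Fin n → ℂ) → ℂ)) (hps : ∀ p ∈ ps, Differentiable ℂ p) :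
    CousinP ps := by
  induction ps with
  | nil => exact cousin_nil
  | cons p ps ih =>
    have h1 : ∀ q ∈ ps, Differentiable ℂ q := fun q hq => hps q (by simp [hq])
    exact cousin_cons ps h1 (ih h1) p (hps p (by simp))

end OkaWeil

namespace OkaWeil
open Set Filter Topology Metric Complex

section
variable {E : Type} [NormedAddCommGroup E] [NormedSpace ℂ E]
  {F : Type} [NormedAddCommGroup F] [NormedSpace ℂ F]

/-- polynomial functions -/
def IsPoly (g : E → ℂ) : Prop :=
  g ∈ Algebra.adjoin ℂ (range (fun ℓ : E →ₗ[ℂ] ℂ => (ℓ : E → ℂ)))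

lemma IsPoly.lin (ℓ : E →ₗ[ℂ] ℂ) : IsPoly (fun x => ℓ x) :=
  Algebra.subset_adjoin ⟨ℓ, rfl⟩

lemma IsPoly.const (c : ℂ) : IsPoly (fun _ : E => c) :=
  Subalgebra.algebraMap_mem _ c

lemma IsPoly.add {f g : E → ℂ} (hf : IsPoly f) (hg : IsPoly g) : IsPoly (fun x => f x + g x) :=
  Subalgebra.add_mem _ hf hg

lemma IsPoly.mul {f g : E → ℂ} (hf : IsPoly f) (hg : IsPoly g) : IsPoly (fun x => f x * g x) :=
  Subalgebra.mul_mem _ hf hg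

lemma IsPoly.pow {f : E → ℂ} (hf : IsPoly f) (k : ℕ) : IsPoly (fun x => f x ^ k) :=
  Subalgebra.pow_mem _ hf k

lemma IsPoly.sum {ι : Type} (s : Finset ι) {f : ι → E → ℂ} (hf : ∀ i ∈ s, IsPoly (f i)) :
    IsPoly (fun x => ∑ i ∈ s, f i x) := by
  have := Subalgebra.sum_mem (Algebra.adjoin ℂ (range (fun ℓ : E →ₗ[ℂ] ℂ => (ℓ : E → ℂ)))) hf
  unfold IsPoly
  convert this using 1
  ext x; simp

lemma IsPoly.comp {g : F → ℂ} (hg : IsPoly g) {φ : E → F}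
    (hφ : ∀ ℓ : F →ₗ[ℂ] ℂ, IsPoly (fun x => ℓ (φ x))) : IsPoly (fun x => g (φ x)) := by
  induction hg using Algebra.adjoin_induction with
  | mem g hg => obtain ⟨ℓ, rfl⟩ := hg; exact hφ ℓ
  | algebraMap r => exact IsPoly.const r
  | add f g _ _ h1 h2 => exact h1.add h2
  | mul f g _ _ h1 h2 => exact h1.mul h2

lemma IsPoly.diff [FiniteDimensional ℂ E] {g : E → ℂ} (hg : IsPoly g) : Differentiable ℂ g := by
  induction hg using Algebra.adjoin_induction with
  | mem g hg =>
    obtain ⟨ℓ, rfl⟩ := hg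
    exact (LinearMap.toContinuousLinearMap ℓ).differentiable
  | algebraMap r => exact differentiable_const r
  | add f g _ _ h1 h2 => exact h1.add h2
  | mul f g _ _ h1 h2 => exact h1.mul h2

end

section
variable {E : Type} [NormedAddCommGroup E] [NormedSpace ℂ E] [FiniteDimensional ℂ E]
  {ι : Type} [Fintype ι] [DecidableEq ι]

def PD (b : Module.Basis ι ℂ E) (r : ℝ) : Set E := {x | ∀ i, ‖b.coord i x‖ ≤ r}

lemma PD_compact (b : Module.Basis ι ℂ E) (r : ℝ) (hr : 0 ≤ r) : IsCompact (PD b r) := by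
  have : PD b r = b.equivFunL.toHomeomorph ⁻¹' closedBall 0 r := by
    ext x
    simp only [PD, mem_ofPred_eq, mem_preimage, mem_closedBall_zero_iff]
    rw [pi_norm_le_iff_of_nonneg hr]
    rfl
  rw [this, Homeomorph.isCompact_preimage]
  exact isCompact_closedBall _ _

lemma poly_approx_aux (b : Module.Basis ι ℂ E) (T : Finset ι) : ∀ (F : E → ℂ), Hol F (PD b 1) →
    (∀ x ∈ PD b 1, ∀ y ∈ PD b 1, (∀ i ∈ T, b.coord i x = b.coord i y) → F x = F y) →
    ∀ ε > 0, ∃ g : E → ℂ, IsPoly g ∧ ∀ x ∈ PD b (1/2), ‖F x - g x‖ < ε := by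
  have hsub : PD b (1/2) ⊆ PD b 1 := fun x hx i => (hx i).trans (by norm_num)
  induction T using Finset.induction_on with
  | empty =>
    intro F hF hinv ε hε
    refine ⟨fun _ => F 0, IsPoly.const _, fun x hx => ?_⟩
    rw [hinv x (hsub hx) 0 (fun i => by simp) (by simp)]
    simpa using hε
  | insert i T hi ih =>
    intro F hF hinv ε hε
    let ℓ : E →L[ℂ] ℂ := LinearMap.toContinuousLinearMap (b.coord i)
    have hℓ : ∀ x, ℓ x = b.coord i x := fun x => rfl
    have hri : ∀ x ζ, b.coord i (repl ℓ (b i) (x, ζ)) = ζ := by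
      intro x ζ; simp [repl, hℓ]
    have hrj : ∀ x ζ j, j ≠ i → b.coord j (repl ℓ (b i) (x, ζ)) = b.coord j x := by
      intro x ζ j hj; simp [repl, hℓ, Finsupp.single_apply, hj.symm]
    have hrPD : ∀ x ∈ PD b 1, ∀ ζ : ℂ, ‖ζ‖ ≤ 1 → repl ℓ (b i) (x, ζ) ∈ PD b 1 := by
      intro x hx ζ hζ j
      by_cases hj : j = i
      · subst hj; rw [hri]; exact hζ
      · rw [hrj _ _ _ hj]; exact hx j
    have hrs : ∀ x, repl ℓ (b i) (x, ℓ x) = x := by intro x; simp [repl]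
    have hrd := repl_diff ℓ (b i)
    have hFc : ContinuousOn F (PD b 1) := fun x hx =>
      (hF.ev hx).self_of_nhds.continuousAt.continuousWithinAt
    obtain ⟨M, hM⟩ := (PD_compact b 1 zero_le_one).exists_bound_of_continuousOn hFc
    have hM0 : 0 ≤ M := (norm_nonneg _).trans (hM 0 (fun i => by simp))
    let c : ℕ → E → ℂ := fun k x => ∫ θ in (0 : ℝ)..(2 * Real.pi),
      deriv (circleMap 0 1) θ * ((2 * Real.pi * I)⁻¹ *
        (((circleMap 0 1 θ)⁻¹) ^ (k + 1) * F (repl ℓ (b i) (x, circleMap 0 1 θ))))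
    have hcH : ∀ k, Hol (c k) (PD b 1) := by
      intro k
      rw [hol_iff]
      intro x hx
      refine paramInt_ev (fun q : E × ℂ => (2 * Real.pi * I)⁻¹ *
        ((q.2⁻¹) ^ (k + 1) * F (repl ℓ (b i) q))) (circleMap 0 1)
        (fun θ => deriv (circleMap 0 1) θ)
        (continuous_circleMap 0 1) (by simp only [deriv_circleMap]; fun_prop) 0 (2 * Real.pi) x ?_
      intro θ _
      have hn : ‖circleMap 0 1 θ‖ = 1 := by simp
      have hc0 : circleMap 0 1 θ ≠ 0 := by
        intro h; rw [h] at hn; simp at hn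
      have h1 := (hrd.continuous.tendsto (x, circleMap 0 1 θ)).eventually
        (hF.ev (hrPD x hx _ hn.le))
      have h2 : ∀ᶠ q : E × ℂ in 𝓝 (x, circleMap 0 1 θ), q.2 ≠ 0 :=
        continuous_snd.continuousAt.eventually_ne hc0
      filter_upwards [h1, h2] with q hq1 hq2
      have d1 : DifferentiableAt ℂ (fun q => F (repl ℓ (b i) q)) q := hq1.comp q (hrd q)
      have d2 : DifferentiableAt ℂ (fun q : E × ℂ => q.2⁻¹) q :=
        differentiableAt_snd.fun_inv hq2
      exact ((d2.fun_pow (k + 1)).fun_mul d1).const_mul _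
    have hcinv : ∀ k, ∀ x ∈ PD b 1, ∀ y ∈ PD b 1, (∀ i ∈ T, b.coord i x = b.coord i y) →
        c k x = c k y := by
      intro k x hx y hy hxy
      apply intervalIntegral.integral_congr
      intro θ _
      have hn : ‖circleMap 0 1 θ‖ = 1 := by simp
      simp only
      rw [hinv _ (hrPD x hx (circleMap 0 1 θ) hn.le) _ (hrPD y hy (circleMap 0 1 θ) hn.le)]
      intro j hj
      by_cases hji : j = i
      · subst hji; rw [hri, hri]
      · rw [hrj _ _ _ hji, hrj _ _ _ hji]
        exact hxy j (by simpa [hji] using hj)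
    have hcb : ∀ k, ∀ x ∈ PD b 1, ‖c k x‖ ≤ M := by
      intro k x hx
      have h1 : ∀ θ ∈ Set.uIoc (0 : ℝ) (2 * Real.pi), ‖deriv (circleMap 0 1) θ * ((2 * Real.pi * I)⁻¹ *
        (((circleMap 0 1 θ)⁻¹) ^ (k + 1) * F (repl ℓ (b i) (x, circleMap 0 1 θ))))‖
          ≤ (2 * Real.pi)⁻¹ * M := by
        intro θ _
        have hn : ‖circleMap 0 1 θ‖ = 1 := by simp
        have := hM _ (hrPD x hx _ hn.le)
        have hpi : ‖(2 * Real.pi * I : ℂ)⁻¹‖ = (2 * Real.pi)⁻¹ := by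
          rw [norm_inv]; simp [abs_of_pos Real.pi_pos]
        rw [norm_mul, norm_mul, norm_mul, hpi, norm_pow, norm_inv, hn, deriv_circleMap, norm_mul, hn]
        simp only [norm_I, inv_one, one_pow, one_mul]
        gcongr
      refine (intervalIntegral.norm_integral_le_of_norm_le_const h1).trans (le_of_eq ?_)
      rw [sub_zero, abs_of_pos (by positivity)]
      field_simp
    have hsum : ∀ x ∈ PD b (1/2), HasSum (fun k => c k x * (ℓ x) ^ k) (F x) := by
      intro x hx
      have hxx := hsub hx
      let g : ℂ → ℂ := fun ζ => F (repl ℓ (b i) (x, ζ))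
      have hg : DifferentiableOn ℂ g (closedBall 0 (1 : NNReal)) := by
        intro ζ hζ
        have h1 := (hF.ev (hrPD x hxx ζ (by simpa using hζ))).self_of_nhds
        have h2 : DifferentiableAt ℂ (fun ζ => repl ℓ (b i) (x, ζ)) ζ :=
          (hrd (x, ζ)).comp ζ (f := fun ζ => (x, ζ)) (by fun_prop)
        exact (h1.comp ζ h2).differentiableWithinAt
      have h3 := hg.hasFPowerSeriesOnBall one_pos
      have hx2 : ‖ℓ x‖ ≤ 1/2 := hx i
      have h4 := h3.hasSum (y := ℓ x) (by
        simp only [Metric.mem_eball, edist_zero_right]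
        rw [← ofReal_norm]
        refine lt_of_le_of_lt (ENNReal.ofReal_le_ofReal hx2) ?_
        simp)
      rw [zero_add] at h4
      have h5 : g (ℓ x) = F x := by simp only [g, hrs]
      rw [h5] at h4
      have h6 : (fun k => c k x * (ℓ x) ^ k) =
          fun k => cauchyPowerSeries g 0 ((1 : NNReal) : ℝ) k fun _ => ℓ x := ?_
      · rw [h6]; exact h4
      funext k
      rw [cauchyPowerSeries_apply, circleIntegral, smul_eq_mul,
        ← intervalIntegral.integral_const_mul, ← intervalIntegral.integral_mul_const]
      apply intervalIntegral.integral_congr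
      intro θ _
      simp only [smul_eq_mul, g, sub_zero, NNReal.coe_one]
      rw [div_pow, inv_pow, pow_succ]
      field_simp
    -- choose N
    obtain ⟨N, hN⟩ : ∃ N : ℕ, M * (1/2) ^ N / (1 - 1/2) < ε / 2 := by
      have : Tendsto (fun N : ℕ => M * (1/2 : ℝ) ^ N / (1 - 1/2)) atTop (𝓝 (M * 0 / (1 - 1/2))) :=
        ((tendsto_pow_atTop_nhds_zero_of_lt_one (by norm_num) (by norm_num)).const_mul M).div_const _
      rw [mul_zero, zero_div] at this
      exact (this.eventually_lt_const (by positivity)).exists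
    have hδ : 0 < ε / 2 / (N + 1) := by positivity
    choose G hG hGa using fun k => ih (c k) (hcH k) (hcinv k) (ε / 2 / (N + 1)) hδ
    refine ⟨fun x => ∑ k ∈ Finset.range N, G k x * (b.coord i x) ^ k,
      IsPoly.sum _ fun k _ => (hG k).mul ((IsPoly.lin (b.coord i)).pow k), fun x hx => ?_⟩
    have hx2 : ‖ℓ x‖ ≤ 1/2 := hx i
    have e1 := norm_sub_le_of_geometric_bound_of_hasSum (r := 1/2) (C := M) (by norm_num)
      (fun k => by
        rw [norm_mul, norm_pow]
        have := hcb k x (hsub hx)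
        gcongr) (hsum x hx) N
    have e2 : ‖∑ k ∈ Finset.range N, c k x * (ℓ x) ^ k -
        ∑ k ∈ Finset.range N, G k x * (b.coord i x) ^ k‖ ≤ ε / 2 := by
      rw [← Finset.sum_sub_distrib]
      refine (norm_sum_le _ _).trans ?_
      have : ∀ k ∈ Finset.range N, ‖c k x * (ℓ x) ^ k - G k x * (b.coord i x) ^ k‖
          ≤ ε / 2 / (N + 1) := by
        intro k _
        rw [hℓ, ← sub_mul, norm_mul, norm_pow]
        have h1 := (hGa k x hx).le
        have h2 : ‖b.coord i x‖ ^ k ≤ 1 := pow_le_one₀ (norm_nonneg _) (hsub hx i)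
        calc _ ≤ ε / 2 / (N + 1) * 1 := by gcongr
          _ = _ := mul_one _
      refine (Finset.sum_le_sum this).trans ?_
      rw [Finset.sum_const, Finset.card_range, nsmul_eq_mul, mul_div_assoc', div_le_iff₀ (by positivity)]
      nlinarith
    rw [norm_sub_rev] at e1
    calc _ = ‖(F x - ∑ k ∈ Finset.range N, c k x * (ℓ x) ^ k) +
        (∑ k ∈ Finset.range N, c k x * (ℓ x) ^ k -
        ∑ k ∈ Finset.range N, G k x * (b.coord i x) ^ k)‖ := by congr 1; ring
      _ ≤ _ := norm_add_le _ _
      _ < ε := by linarith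

lemma poly_approx (b : Module.Basis ι ℂ E) (F : E → ℂ) (hF : Hol F (PD b 1)) (ε : ℝ) (hε : 0 < ε) :
    ∃ g : E → ℂ, IsPoly g ∧ ∀ x ∈ PD b (1/2), ‖F x - g x‖ < ε := by
  refine poly_approx_aux b Finset.univ F hF ?_ ε hε
  intro x _ y _ h
  rw [b.ext_elem (fun i => h i (Finset.mem_univ i))]

end
end OkaWeil

namespace OkaWeil
open Set Filter Topology Metric Complex

variable {n : ℕ}

lemma PD_prod {E F ι κ : Type} [NormedAddCommGroup E] [NormedSpace ℂ E]
    [NormedAddCommGroup F] [NormedSpace ℂ F] (b : Module.Basis ι ℂ E)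
    (c : Module.Basis κ ℂ F) (r : ℝ) : PD (b.prod c) r = PD b r ×ˢ PD c r := by
  ext ⟨x, y⟩
  simp [PD]

lemma PD_singleton (r : ℝ) : PD (Module.Basis.singleton Unit ℂ) r = closedBall (0 : ℂ) r := by
  ext x
  simp [PD]

lemma mem_box_of_norm {R : ℝ} {z : Fin n → ℂ} (h : ‖z‖ ≤ R) :
    z ∈ box (fun _ => -R) (fun _ => R) := by
  rintro ⟨i, β⟩
  have h1 : ‖z i‖ ≤ R := (norm_le_pi_norm z i).trans h
  have h2 := (Complex.abs_re_le_norm (z i)).trans h1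
  have h3 := (Complex.abs_im_le_norm (z i)).trans h1
  rw [abs_le] at h2 h3
  cases β
  · simpa [rho] using h2
  · simpa [rho] using h3

lemma approxA (R : ℝ) (hR : 0 < R) (ps : List ((Fin n → ℂ) → ℂ)) (hps : ∀ p ∈ ps, IsPoly p) :
    ∀ (W : Type) [NormedAddCommGroup W] [NormedSpace ℂ W] [FiniteDimensional ℂ W]
      (ι : Type) [Fintype ι] [DecidableEq ι] (bW : Module.Basis ι ℂ W) (f : (Fin n → ℂ) × W → ℂ),
      Hol f ((box (fun _ => -R) (fun _ => R) ∩ PP ps) ×ˢ PD bW 1) → ∀ ε > 0,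
      ∃ g : (Fin n → ℂ) × W → ℂ, IsPoly g ∧ ∀ z, ‖z‖ ≤ R / 2 → (∀ p ∈ ps, ‖p z‖ ≤ 1 / 2) →
        ∀ w ∈ PD bW (1 / 2), ‖f (z, w) - g (z, w)‖ < ε := by
  induction ps with
  | nil =>
    intro W _ _ _ ι _ _ bW f hf ε hε
    have hRc : (R : ℂ) ≠ 0 := by exact_mod_cast hR.ne'
    have hbasis : ∀ r : ℝ, 0 ≤ r → PD (Pi.basisFun ℂ (Fin n)) r = {z | ‖z‖ ≤ r} := by
      intro r hr
      ext z
      simp [PD, pi_norm_le_iff_of_nonneg hr]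
    obtain ⟨G, hG, hGa⟩ := poly_approx ((Pi.basisFun ℂ (Fin n)).prod bW)
      (fun x => f ((R : ℂ) • x.1, x.2)) (by
        refine hf.comp (φ := fun x : (Fin n → ℂ) × W => ((R : ℂ) • x.1, x.2)) (by fun_prop) ?_
        rw [PD_prod, hbasis 1 zero_le_one]
        rintro ⟨z, w⟩ ⟨hz, hw⟩
        refine ⟨⟨mem_box_of_norm ?_, by simp [PP]⟩, hw⟩
        have hz : ‖z‖ ≤ 1 := hz
        simp only [norm_smul, norm_real, Real.norm_eq_abs, abs_of_pos hR]
        nlinarith) ε hε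
    refine ⟨fun x => G ((R : ℂ)⁻¹ • x.1, x.2), hG.comp fun ℓ => ?_, fun z hz _ w hw => ?_⟩
    · let L : (Fin n → ℂ) × W →ₗ[ℂ] (Fin n → ℂ) × W :=
        LinearMap.prodMap ((R : ℂ)⁻¹ • (LinearMap.id : (Fin n → ℂ) →ₗ[ℂ] (Fin n → ℂ)))
          (LinearMap.id : W →ₗ[ℂ] W)
      exact IsPoly.lin (ℓ.comp L)
    · have := hGa ((R : ℂ)⁻¹ • z, w) (by
        rw [PD_prod, hbasis _ (by norm_num)]
        refine ⟨?_, hw⟩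
        change ‖(R : ℂ)⁻¹ • z‖ ≤ 1 / 2
        rw [norm_smul, norm_inv, norm_real, Real.norm_eq_abs, abs_of_pos hR,
          inv_mul_le_iff₀ hR]
        linarith)
      simpa [smul_smul, hRc] using this
  | cons p ps ih =>
    intro W _ _ _ ι _ _ bW f hf ε hε
    have h1 : ∀ q ∈ ps, IsPoly q := fun q hq => hps q (by simp [hq])
    have h2 : ∀ q ∈ ps, Differentiable ℂ q := fun q hq => (h1 q hq).diff
    have hp : IsPoly p := hps p (by simp)
    rw [PP_cons, ← inter_assoc] at hf
    obtain ⟨F, hF, hFf⟩ := lift ps h2 (cousin_all ps h2) p hp.diff (PD bW 1)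
      (PD_compact bW 1 zero_le_one) f _ _ hf
    obtain ⟨G, hG, hGa⟩ := ih h1 (ℂ × W) (Unit ⊕ ι) ((Module.Basis.singleton Unit ℂ).prod bW) F (by
      rw [PD_prod, PD_singleton]; exact hF) ε hε
    refine ⟨fun x => G (x.1, (p x.1, x.2)), hG.comp fun ℓ => ?_, fun z hz hpz w hw => ?_⟩
    · have e1 : IsPoly (fun x : (Fin n → ℂ) × W => p x.1) :=
        hp.comp fun ℓ => IsPoly.lin (ℓ.comp (LinearMap.fst ℂ (Fin n → ℂ) W))
      have e2 : IsPoly (fun x : (Fin n → ℂ) × W => ℓ (x.1, (0, x.2))) :=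
        IsPoly.lin (ℓ.comp (LinearMap.prodMap LinearMap.id (LinearMap.inr ℂ ℂ W)))
      have e3 := e2.add (e1.mul (IsPoly.const (ℓ (0, (1, 0)))))
      convert e3 using 1
      funext x
      rw [← smul_eq_mul, ← map_smul, ← map_add]
      simp
    · have hpz' := hpz p (by simp)
      have e1 : F (z, (p z, w)) = f (z, w) := by
        rw [eventually_nhdsSet_iff_forall] at hFf
        refine (hFf (z, w) ⟨⟨⟨mem_box_of_norm (by linarith), ?_⟩, ?_⟩, ?_⟩).self_of_nhds
        · intro q hq
          have := hpz q (by simp [hq])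
          simp only [mem_closedBall_zero_iff]; linarith
        · simp only [mem_preimage, mem_closedBall_zero_iff]; linarith
        · exact fun i => (hw i).trans (by norm_num)
      rw [← e1]
      refine hGa z hz (fun q hq => hpz q (by simp [hq])) (p z, w) ?_
      rw [PD_prod, PD_singleton]
      exact ⟨by simpa using hpz', hw⟩

lemma isPoly_eval (q : MvPolynomial (Fin n) ℂ) : IsPoly (fun z : Fin n → ℂ => eval z q) := by
  induction q using MvPolynomial.induction_on with
  | C a => simpa using IsPoly.const a
  | add p q hp hq => simpa using hp.add hq
  | mul_X p i hp => simpa using hp.mul (IsPoly.lin (LinearMap.proj i : (Fin n → ℂ) →ₗ[ℂ] ℂ))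

lemma exists_eval {g : (Fin n → ℂ) → ℂ} (hg : IsPoly g) :
    ∃ q : MvPolynomial (Fin n) ℂ, ∀ z, g z = eval z q := by
  induction hg using Algebra.adjoin_induction with
  | mem g hg =>
    obtain ⟨ℓ, rfl⟩ := hg
    refine ⟨∑ i, X i * C (ℓ (Pi.single i 1)), fun z => ?_⟩
    simp only [map_sum, map_mul, eval_X, eval_C]
    conv_lhs => rw [show z = ∑ i, z i • (Pi.single i (1 : ℂ) : Fin n → ℂ) from
      (pi_eq_sum_univ' z)]
    simp
  | algebraMap r => exact ⟨C r, fun z => by simp [Pi.algebraMap_apply]⟩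
  | add f g _ _ h1 h2 =>
    obtain ⟨p, hp⟩ := h1
    obtain ⟨q, hq⟩ := h2
    exact ⟨p + q, fun z => by simp [hp, hq]⟩
  | mul f g _ _ h1 h2 =>
    obtain ⟨p, hp⟩ := h1
    obtain ⟨q, hq⟩ := h2
    exact ⟨p * q, fun z => by simp [hp, hq]⟩

lemma separate (K : Set (Fin n → ℂ)) (hK : IsCompact K)
    (z : Fin n → ℂ) (p : MvPolynomial (Fin n) ℂ)
    (hp : (⨆ x : K, ‖eval (x : Fin n → ℂ) p‖) < ‖eval z p‖) :
    ∃ q : (Fin n → ℂ) → ℂ, IsPoly q ∧ (∀ x ∈ K, ‖q x‖ ≤ 1 / 2) ∧ 1 < ‖q z‖ := by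
  set S := ⨆ x : K, ‖eval (x : Fin n → ℂ) p‖ with hS
  have hS0 : 0 ≤ S := Real.iSup_nonneg fun _ => norm_nonneg _
  have hle : ∀ x ∈ K, ‖eval x p‖ ≤ S := by
    intro x hx
    have hc : Continuous (fun x : Fin n → ℂ => ‖eval x p‖) := (isPoly_eval p).diff.continuous.norm
    have hb : BddAbove (range fun x : K => ‖eval (x : Fin n → ℂ) p‖) := by
      have := (hK.image hc).bddAbove
      rwa [image_eq_range] at this
    exact le_ciSup hb (⟨x, hx⟩ : K)
  obtain ⟨m, hm1, hm2⟩ := exists_between hp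
  have hm : 0 < m := hS0.trans_lt hm1
  have ht : Tendsto (fun N : ℕ => (S / m) ^ N) atTop (𝓝 0) :=
    tendsto_pow_atTop_nhds_zero_of_lt_one (by positivity) (by rwa [div_lt_one hm])
  obtain ⟨N, hN, hN1⟩ := ((ht.eventually_lt_const (show (0 : ℝ) < 1 / 2 by norm_num)).and
    (eventually_ge_atTop 1)).exists
  have hnorm : ∀ x, ‖(((m : ℂ)⁻¹ * eval x p) ^ N)‖ = (‖eval x p‖ / m) ^ N := by
    intro x
    rw [norm_pow, norm_mul, norm_inv, norm_real, Real.norm_eq_abs, abs_of_pos hm]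
    ring
  refine ⟨fun x => ((m : ℂ)⁻¹ * eval x p) ^ N, ((IsPoly.const _).mul (isPoly_eval p)).pow N, ?_, ?_⟩
  · intro x hx
    rw [hnorm]
    refine le_trans ?_ hN.le
    have := hle x hx
    gcongr
  · rw [hnorm]
    exact one_lt_pow₀ (by rwa [one_lt_div hm]) (by omega)

theorem okaWeil (K : Set (Fin n → ℂ)) (hK : IsCompact K)
    (hull : ∀ z : Fin n → ℂ, (∀ p : MvPolynomial (Fin n) ℂ,
        ‖eval z p‖ ≤ ⨆ x : K, ‖eval (x : Fin n → ℂ) p‖) → z ∈ K)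
    (U : Set (Fin n → ℂ)) (hU : IsOpen U) (hKU : K ⊆ U) (g : (Fin n → ℂ) → ℂ)
    (hg : DifferentiableOn ℂ g U) (ε : ℝ) (hε : 0 < ε) :
    ∃ q : MvPolynomial (Fin n) ℂ, ∀ x ∈ K, ‖eval x q - g x‖ < ε := by
  classical
  obtain ⟨r, hr0, hr⟩ := hK.isBounded.exists_pos_norm_le
  set Q := box (fun _ : Fin n × Bool => -(2 * r)) (fun _ => 2 * r) with hQ
  have hsep : ∀ z : Fin n → ℂ, ∃ q : (Fin n → ℂ) → ℂ, IsPoly q ∧ (∀ x ∈ K, ‖q x‖ ≤ 1 / 2) ∧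
      (z ∉ K → 1 < ‖q z‖) := by
    intro z
    by_cases hz : z ∈ K
    · exact ⟨fun _ => 0, IsPoly.const 0, by simp, fun h => absurd hz h⟩
    · have := mt (hull z) hz
      push Not at this
      obtain ⟨p, hp⟩ := this
      obtain ⟨q, h1, h2, h3⟩ := separate K hK z p hp
      exact ⟨q, h1, h2, fun _ => h3⟩
  choose q hqp hqK hqz using hsep
  have hcomp : IsCompact (Q \ U) := (box_compact _ _).diff hU
  obtain ⟨t, -, ht⟩ := hcomp.elim_nhds_subcover (fun z => {y | 1 < ‖q z y‖} ) (by
    intro z hz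
    have hc : Continuous (fun y => ‖q z y‖) := (hqp z).diff.continuous.norm
    exact (isOpen_lt continuous_const hc).mem_nhds (hqz z fun h => hz.2 (hKU h)))
  let ps : List ((Fin n → ℂ) → ℂ) := t.toList.map q
  have hps : ∀ p ∈ ps, ∃ z ∈ t, q z = p := by
    intro p hp
    simpa [ps] using hp
  have hPU : Q ∩ PP ps ⊆ U := by
    rintro z ⟨hz, hP⟩
    by_contra hzU
    have := ht ⟨hz, hzU⟩
    simp only [mem_iUnion] at this
    obtain ⟨y, hy, hy'⟩ := this
    have h1 := hP (q y) (by simp only [ps, List.mem_map, Finset.mem_toList]; exact ⟨y, hy, rfl⟩)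
    rw [mem_closedBall_zero_iff] at h1
    exact absurd h1 (not_le.2 hy')
  obtain ⟨G, hG, hGa⟩ := approxA (2 * r) (by positivity) ps (fun p hp => by
      obtain ⟨z, -, rfl⟩ := hps p hp
      exact hqp z) ℂ Unit (Module.Basis.singleton Unit ℂ) (fun x => g x.1) (by
      have h1 : Hol g U := hol_iff.2 fun x hx => by
        filter_upwards [hU.mem_nhds hx] with y hy
        exact (hg y hy).differentiableAt (hU.mem_nhds hy)
      refine h1.comp (φ := fun x : (Fin n → ℂ) × ℂ => x.1) (by fun_prop) ?_
      rintro ⟨z, w⟩ ⟨hz, -⟩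
      exact hPU hz) ε hε
  have hG0 : IsPoly (fun z : Fin n → ℂ => G (z, 0)) :=
    hG.comp fun ℓ => IsPoly.lin (ℓ.comp (LinearMap.inl ℂ (Fin n → ℂ) ℂ))
  obtain ⟨Qp, hQp⟩ := exists_eval hG0
  refine ⟨Qp, fun x hx => ?_⟩
  rw [← hQp, norm_sub_rev]
  refine hGa x (by have := hr x hx; linarith) ?_ 0 (fun i => by simp)
  intro p hp
  obtain ⟨z, -, rfl⟩ := hps p hp
  exact hqK z x hx

end OkaWeil

namespace OkaWeil
open Set Filter Topology Metric Complex

variable {n : ℕ}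

lemma polySeq (k : Set (Fin n → ℂ)) (hk : IsCompact k) : ∃ q : ℕ → MvPolynomial (Fin n) ℂ,
    ∀ P : MvPolynomial (Fin n) ℂ, ∀ δ > 0, ∃ j, ∀ x ∈ k, ‖eval x (q j) - eval x P‖ < δ := by
  have : CompactSpace k := isCompact_iff_compactSpace.1 hk
  let φ : MvPolynomial (Fin n) ℂ → C(k, ℂ) := fun P =>
    ⟨fun x => eval (x : Fin n → ℂ) P, (isPoly_eval P).diff.continuous.comp continuous_subtype_val⟩
  have : Nonempty (range φ) := ⟨⟨φ 0, 0, rfl⟩⟩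
  choose q hq using fun j => (denseSeq (range φ) j).2
  refine ⟨q, fun P δ hδ => ?_⟩
  obtain ⟨_, hy, j, rfl⟩ := (denseRange_denseSeq (range φ)).exists_mem_open
    (isOpen_ball (x := (⟨φ P, P, rfl⟩ : range φ)) (ε := δ)) ⟨_, mem_ball_self hδ⟩ |> fun ⟨j, hj⟩ =>
      (⟨_, hj, j, rfl⟩ : ∃ y, y ∈ ball (⟨φ P, P, rfl⟩ : range φ) δ ∧ ∃ j, denseSeq (range φ) j = y)
  refine ⟨j, fun x hx => ?_⟩
  rw [mem_ball, Subtype.dist_eq, ← hq j] at hy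
  have := (ContinuousMap.dist_apply_le_dist (f := φ (q j)) (g := φ P) ⟨x, hx⟩).trans_lt hy
  rwa [dist_eq_norm] at this

end OkaWeil

theorem random_oka_weil
    {Ω : Type*} [MeasurableSpace Ω] (μ : Measure Ω) [SigmaFinite μ] {n : ℕ}
    [MeasurableSpace (NonemptyCompacts (Fin n → ℂ))]
    [BorelSpace (NonemptyCompacts (Fin n → ℂ))]
    (K : Ω → NonemptyCompacts (Fin n → ℂ)) (hK : Measurable K)
    (hK_range : (Set.range K).Countable)
    (hK_polyconvex : ∀ ω : Ω,
      {z : Fin n → ℂ | ∀ p : MvPolynomial (Fin n) ℂ,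
        ‖eval z p‖ ≤ ⨆ x : (K ω : Set (Fin n → ℂ)), ‖eval (x : Fin n → ℂ) p‖}
      = (K ω : Set (Fin n → ℂ)))
    (f : Ω → (Fin n → ℂ) → ℂ)
    (hf_meas : ∀ z : Fin n → ℂ, Measurable fun ω : {ω : Ω // z ∈ K ω} => f ω z)
    (hf_hol : ∀ ω : Ω, ∃ U : Set (Fin n → ℂ), IsOpen U ∧ (K ω : Set (Fin n → ℂ)) ⊆ U ∧
      ∃ g : (Fin n → ℂ) → ℂ, DifferentiableOn ℂ g U ∧
        ∀ z ∈ (K ω : Set (Fin n → ℂ)), g z = f ω z)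
    (ε : Ω → ℝ) (hε_meas : Measurable ε) (hε_pos : ∀ ω, 0 < ε ω) :
    ∃ p : Ω → (Fin n → ℂ) → ℂ,
      (∀ ω : Ω, ∃ q : MvPolynomial (Fin n) ℂ, ∀ z : Fin n → ℂ, p ω z = eval z q) ∧
      (∀ z : Fin n → ℂ, Measurable fun ω : {ω : Ω // z ∈ K ω} => p ω z) ∧
      ∃ L : Set Ω, MeasurableSet L ∧ μ L = 0 ∧
        ∀ ω ∉ L, ∀ x ∈ (K ω : Set (Fin n → ℂ)), ‖p ω x - f ω x‖ < ε ω := by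
  classical
  choose q hq using fun k : NonemptyCompacts (Fin n → ℂ) =>
    OkaWeil.polySeq (k : Set (Fin n → ℂ)) k.isCompact
  have hd : ∀ k : NonemptyCompacts (Fin n → ℂ), ∃ d : ℕ → (k : Set (Fin n → ℂ)), DenseRange d := by
    intro k
    have : Nonempty (k : Set (Fin n → ℂ)) := k.nonempty.to_subtype
    exact ⟨denseSeq _, denseRange_denseSeq _⟩
  choose d hd using hd
  have hex : ∀ ω, ∃ j, ∀ m, ‖eval (d (K ω) m : Fin n → ℂ) (q (K ω) j) - f ω (d (K ω) m)‖
      ≤ ε ω / 2 := by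
    intro ω
    obtain ⟨U, hU, hKU, g, hg, hgf⟩ := hf_hol ω
    obtain ⟨P, hP⟩ := OkaWeil.okaWeil (K ω : Set (Fin n → ℂ)) (K ω).isCompact
      (fun z hz => by rw [← hK_polyconvex ω]; exact hz) U hU hKU g hg (ε ω / 4)
      (by have := hε_pos ω; linarith)
    obtain ⟨j, hj⟩ := hq (K ω) P (ε ω / 4) (by have := hε_pos ω; linarith)
    refine ⟨j, fun m => ?_⟩
    have h1 := hP _ (d (K ω) m).2
    have h2 := hj _ (d (K ω) m).2
    rw [← hgf _ (d (K ω) m).2]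
    calc _ = ‖(eval (d (K ω) m : Fin n → ℂ) (q (K ω) j) - eval (d (K ω) m : Fin n → ℂ) P) +
        (eval (d (K ω) m : Fin n → ℂ) P - g (d (K ω) m))‖ := by congr 1; ring
      _ ≤ _ := norm_add_le _ _
      _ ≤ _ := by linarith
  let J : Ω → ℕ := fun ω => Nat.find (hex ω)
  have hSk : ∀ k, MeasurableSet (K ⁻¹' {k}) := fun k => hK (measurableSet_singleton k)
  have hcond : ∀ k j, MeasurableSet {ω | K ω = k ∧
      ∀ m, ‖eval (d (K ω) m : Fin n → ℂ) (q (K ω) j) - f ω (d (K ω) m)‖ ≤ ε ω / 2} := by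
    intro k j
    have h1 : {ω | K ω = k ∧
        ∀ m, ‖eval (d (K ω) m : Fin n → ℂ) (q (K ω) j) - f ω (d (K ω) m)‖ ≤ ε ω / 2} =
        ⋂ m, Subtype.val '' {ω : K ⁻¹' {k} |
          ‖eval (d k m : Fin n → ℂ) (q k j) - f ω (d k m)‖ ≤ ε ω / 2} := by
      ext ω
      simp only [Set.mem_ofPred_eq, Set.mem_iInter, Set.mem_image, Subtype.exists,
        exists_and_right, exists_eq_right, Set.mem_preimage, Set.mem_singleton_iff]
      constructor
      · rintro ⟨rfl, h⟩ m
        exact ⟨rfl, h m⟩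
      · intro h
        obtain ⟨rfl, -⟩ := h 0
        exact ⟨rfl, fun m => (h m).2⟩
    rw [h1]
    refine MeasurableSet.iInter fun m => (hSk k).subtype_image ?_
    have h2 : Measurable (fun ω : K ⁻¹' {k} => f ω (d k m)) := by
      let inc : K ⁻¹' {k} → {ω : Ω // (d k m : Fin n → ℂ) ∈ K ω} := fun ω =>
        ⟨ω.1, by
          have : K ω.1 = k := ω.2
          rw [this]; exact (d k m).2⟩
      exact (hf_meas (d k m)).comp (g := fun ω : {ω : Ω // (d k m : Fin n → ℂ) ∈ K ω} =>
        f ω (d k m)) (f := inc) (measurable_subtype_coe.subtype_mk)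
    have h3 : Measurable (fun ω : K ⁻¹' {k} => ε ω / 2) :=
      (hε_meas.comp measurable_subtype_coe).div_const 2
    exact measurableSet_le (measurable_const.sub h2).norm h3
  have hJ : ∀ k j, MeasurableSet {ω | K ω = k ∧ J ω = j} := by
    intro k j
    have h1 : {ω | K ω = k ∧ J ω = j} = {ω | K ω = k ∧
        ∀ m, ‖eval (d (K ω) m : Fin n → ℂ) (q (K ω) j) - f ω (d (K ω) m)‖ ≤ ε ω / 2} \
        ⋃ i ∈ Set.Iio j, {ω | K ω = k ∧
          ∀ m, ‖eval (d (K ω) m : Fin n → ℂ) (q (K ω) i) - f ω (d (K ω) m)‖ ≤ ε ω / 2} := by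
      ext ω
      simp only [J, Nat.find_eq_iff, Set.mem_ofPred_eq, Set.mem_sdiff, Set.mem_iUnion, Set.mem_Iio]
      constructor
      · rintro ⟨hk, hj, hn⟩
        refine ⟨⟨hk, hj⟩, ?_⟩
        rintro ⟨i, hi, -, hi'⟩
        exact hn i hi hi'
      · rintro ⟨⟨hk, hj⟩, hn⟩
        exact ⟨hk, hj, fun i hi h => hn ⟨i, hi, hk, h⟩⟩
    rw [h1]
    exact (hcond k j).diff (MeasurableSet.biUnion (Set.to_countable _) fun i _ => hcond k i)
  refine ⟨fun ω z => eval z (q (K ω) (J ω)), fun ω => ⟨_, fun z => rfl⟩, fun z => ?_,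
    ∅, MeasurableSet.empty, by simp, fun ω _ x hx => ?_⟩
  · have h1 : Measurable (fun ω => eval z (q (K ω) (J ω))) := by
      intro t ht
      have h2 : (fun ω => eval z (q (K ω) (J ω))) ⁻¹' t =
          ⋃ k ∈ Set.range K, ⋃ j ∈ {j : ℕ | eval z (q k j) ∈ t}, {ω | K ω = k ∧ J ω = j} := by
        ext ω
        simp only [Set.mem_preimage, Set.mem_iUnion, Set.mem_ofPred_eq, exists_prop]
        constructor
        · intro h
          exact ⟨K ω, ⟨ω, rfl⟩, J ω, h, rfl, rfl⟩
        · rintro ⟨k, -, j, h, rfl, rfl⟩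
          exact h
      rw [h2]
      exact MeasurableSet.biUnion hK_range fun k _ =>
        MeasurableSet.biUnion (Set.to_countable _) fun j _ => hJ k j
    exact h1.comp measurable_subtype_coe
  · obtain ⟨U, hU, hKU, g, hg, hgf⟩ := hf_hol ω
    have hspec := Nat.find_spec (hex ω)
    have hcont : Continuous (fun y : (K ω : Set (Fin n → ℂ)) =>
        ‖eval (y : Fin n → ℂ) (q (K ω) (J ω)) - g y‖) := by
      have c1 : Continuous (fun y : (K ω : Set (Fin n → ℂ)) =>
          eval (y : Fin n → ℂ) (q (K ω) (J ω))) :=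
        (OkaWeil.isPoly_eval _).diff.continuous.comp continuous_subtype_val
      have c2 : Continuous (fun y : (K ω : Set (Fin n → ℂ)) => g y) :=
        continuousOn_iff_continuous_domRestrict.1 (hg.continuousOn.mono hKU)
      exact (c1.sub c2).norm
    have hall : ∀ y : (K ω : Set (Fin n → ℂ)),
        ‖eval (y : Fin n → ℂ) (q (K ω) (J ω)) - g y‖ ≤ ε ω / 2 := by
      intro y
      refine (hd (K ω)).induction_on y (isClosed_le hcont continuous_const) fun m => ?_
      rw [hgf _ (d (K ω) m).2]
      exact hspec m
    have := hall ⟨x, hx⟩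
    rw [← hgf x hx]
    have h0 := hε_pos ω
    exact lt_of_le_of_lt this (by linarith)
end
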